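/- arXiv:1603.07471 — 3 statements merged into one kernel-verified Lean document; each statement's English description precedes it below -/
import Mathlib

section
/- Let p be an odd prime, q = p^h, and n ≥ 3. Let G = Aut(𝔽_q^n) be the group of all integral automorphisms of 𝔽_q^n, viewed as a subgroup of the symmetric group on 𝔽_q^n, and let E ≤ G be the subgroup of translations x ↦ x + b (b ∈ 𝔽_q^n). Then E is a normal subgroup of G and every nontrivial normal subgroup of G contains E; in particular E is the unique minimal normal subgroup of G, i.e. soc(G) = E. -/
open scoped Classical in
/-- The number of isotropic vectors orthogonal to every member of `v`, as an element of `F`. -/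
noncomputable def isotropicCount {F : Type*} [Field F] [Fintype F] {n : ℕ} {ι : Type*}
    (v : ι → Fin n → F) : F :=
  ((Finset.univ.filter fun u : Fin n → F => u ⬝ᵥ u = 0 ∧ ∀ i, u ⬝ᵥ v i = 0).card : F)

namespace MvPolynomial

variable {σ K : Type*} [Field K]

/-- Two polynomials of degree at most `d` with the same part in degree `d`. -/
structure SameLeading (d : ℕ) (f g : MvPolynomial σ K) : Prop where
  left : f.totalDegree ≤ d
  right : g.totalDegree ≤ d
  sub : (f - g).totalDegree < d

theorem SameLeading.mul {d e : ℕ} {f g f' g' : MvPolynomial σ K} (h : SameLeading d f g)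
    (h' : SameLeading e f' g') : SameLeading (d + e) (f * f') (g * g') where
  left := (totalDegree_mul _ _).trans (add_le_add h.left h'.left)
  right := (totalDegree_mul _ _).trans (add_le_add h.right h'.right)
  sub := by
    have : f * f' - g * g' = f * (f' - g') + (f - g) * g' := by ring
    rw [this]
    refine (totalDegree_add _ _).trans_lt (max_lt ?_ ?_)
    · exact (totalDegree_mul _ _).trans_lt (add_lt_add_of_le_of_lt h.left h'.sub)
    · exact (totalDegree_mul _ _).trans_lt (add_lt_add_of_lt_of_le h.sub h'.right)

theorem SameLeading.pow {d : ℕ} {f g : MvPolynomial σ K} (h : SameLeading d f g) {k : ℕ}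
    (hk : k ≠ 0) : SameLeading (d * k) (f ^ k) (g ^ k) := by
  obtain ⟨k, rfl⟩ := Nat.exists_eq_succ_of_ne_zero hk
  induction k with
  | zero => simpa using h
  | succ k ih =>
    have := (ih (Nat.succ_ne_zero k)).mul h
    rwa [← pow_succ, ← pow_succ, ← Nat.mul_succ] at this

theorem SameLeading.one_sub {d : ℕ} {f g : MvPolynomial σ K} (h : SameLeading d f g) :
    SameLeading d (1 - f) (1 - g) where
  left := (totalDegree_sub _ _).trans (by simpa using h.left)
  right := (totalDegree_sub _ _).trans (by simpa using h.right)
  sub := by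
    have : 1 - f - (1 - g) = -(f - g) := by ring
    rw [this, totalDegree_neg]
    exact h.sub

theorem SameLeading.sub_C {d : ℕ} {f : MvPolynomial σ K} (hd : 0 < d) (h : f.totalDegree ≤ d)
    (a b : K) : SameLeading d (f - C a) (f - C b) where
  left := (totalDegree_sub_C_le _ _).trans h
  right := (totalDegree_sub_C_le _ _).trans h
  sub := by
    have : f - C a - (f - C b) = C (b - a) := by rw [C_sub]; ring
    rwa [this, totalDegree_C]

theorem SameLeading.mul_prod {ι : Type*} {d e : ℕ} {f g : MvPolynomial σ K}
    (h : SameLeading d f g) (s : Finset ι) {f' g' : ι → MvPolynomial σ K}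
    (h' : ∀ i, SameLeading e (f' i) (g' i)) :
    SameLeading (d + s.card * e) (f * ∏ i ∈ s, f' i) (g * ∏ i ∈ s, g' i) := by
  classical
  induction s using Finset.induction_on with
  | empty => simpa using h
  | insert i s hi ih =>
    have := ih.mul (h' i)
    rw [Finset.prod_insert hi, Finset.prod_insert hi, Finset.card_insert_of_notMem hi,
      mul_comm (f' i), mul_comm (g' i), ← mul_assoc, ← mul_assoc]
    convert this using 1
    ring

end MvPolynomial

theorem two_ne_zero_iff_ringChar {F : Type*} [Field F] : (2 : F) ≠ 0 ↔ ringChar F ≠ 2 := by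
  refine ⟨fun h h' => h ?_, fun h => Ring.two_ne_zero h⟩
  have := ringChar.Nat.cast_ringChar (R := F)
  rw [h'] at this
  exact_mod_cast this

section Counting

variable {F : Type*} [Field F] [Fintype F] {n : ℕ} {ι : Type*} [Fintype ι]

open MvPolynomial in
open scoped Classical in
/-- By the Chevalley–Warning argument, the number of solutions of one quadratic and `n - 2` linear
equations in `n` variables does not depend on the constant terms, modulo the characteristic. -/
theorem card_quadric_inter_eq_isotropicCount (hn : Fintype.card ι + 2 = n) (v : ι → Fin n → F)
    (t : F) (b : ι → F) :
    ((Finset.univ.filter fun u : Fin n → F => u ⬝ᵥ u = t ∧ ∀ i, u ⬝ᵥ v i = b i).card : F) =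
      isotropicCount v := by
  set q := Fintype.card F with hq
  have hq1 : q - 1 ≠ 0 := by have := Fintype.one_lt_card (α := F); omega
  let Q : MvPolynomial (Fin n) F := ∑ j, X j * X j
  let L : ι → MvPolynomial (Fin n) F := fun i => ∑ j, X j * C (v i j)
  let P : F → (ι → F) → MvPolynomial (Fin n) F := fun t b =>
    (1 - (Q - C t) ^ (q - 1)) * ∏ i, (1 - (L i - C (b i)) ^ (q - 1))
  have hQ : Q.totalDegree ≤ 2 := totalDegree_finsetSum_le fun j _ =>
    (totalDegree_mul _ _).trans (by simp)
  have hL : ∀ i, (L i).totalDegree ≤ 1 := fun i => totalDegree_finsetSum_le fun j _ =>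
    (totalDegree_mul _ _).trans (by simp)
  have key : ∀ t b, ∑ u, eval u (P t b) =
      ((Finset.univ.filter fun u : Fin n → F => u ⬝ᵥ u = t ∧ ∀ i, u ⬝ᵥ v i = b i).card : F) := by
    intro t b
    rw [Finset.card_filter, Nat.cast_sum]
    refine Finset.sum_congr rfl fun u _ => ?_
    have hind : ∀ a c : F, 1 - (a - c) ^ (q - 1) = if a = c then 1 else 0 := by
      intro a c
      split_ifs with h
      · simp [h, hq1]
      · rw [FiniteField.pow_card_sub_one_eq_one _ (sub_ne_zero.2 h), sub_self]
    have hQe : eval u Q = u ⬝ᵥ u := by simp [Q, dotProduct]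
    have hLe : ∀ i, eval u (L i) = u ⬝ᵥ v i := by simp [L, dotProduct]
    simp only [P, map_mul, map_prod, map_sub, map_one, map_pow, eval_C, hQe, hLe, hind,
      Finset.prod_ite_zero, Finset.prod_const_one]
    by_cases h1 : u ⬝ᵥ u = t <;> by_cases h2 : ∀ i, u ⬝ᵥ v i = b i <;> simp [h1, h2]
  have hsame : SameLeading ((q - 1) * n) (P t b) (P 0 fun _ => 0) := by
    have := (((SameLeading.sub_C two_pos hQ t 0).pow hq1).one_sub).mul_prod Finset.univ
      fun i => ((SameLeading.sub_C one_pos (hL i) (b i) 0).pow hq1).one_sub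
    convert this using 1
    rw [← hn, Finset.card_univ]
    ring
  have h0 := sum_eval_eq_zero (P t b - P 0 fun _ => 0) (by simpa using hsame.sub)
  simp only [map_sub, Finset.sum_sub_distrib, key, sub_eq_zero] at h0
  rw [h0, isotropicCount]
  congr!

open scoped Classical in
theorem two_mul_card_squares (hF : (2 : F) ≠ 0) :
    (2 : F) * ((Finset.univ.filter fun a : F => IsSquare a).card : F) = 1 := by
  have hchar := two_ne_zero_iff_ringChar.1 hF
  have h2 : ∀ a : F, (2 * (if IsSquare a then 1 else 0) : ℤ) =
      quadraticChar F a + 1 + if a = 0 then 1 else 0 := by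
    intro a
    by_cases h0 : a = 0
    · simp [h0]
    · by_cases hs : IsSquare a
      · simp [h0, hs, (quadraticChar_one_iff_isSquare h0).2 hs]
      · simp [h0, hs, quadraticChar_neg_one_iff_not_isSquare.2 hs]
  have h3 := Finset.sum_congr (rfl : (Finset.univ : Finset F) = _) fun a _ => h2 a
  rw [← Finset.mul_sum, Finset.sum_add_distrib, Finset.sum_add_distrib,
    quadraticChar_sum_zero hchar, Finset.sum_ite_eq' Finset.univ (0 : F)] at h3
  have h4 := congrArg (Int.cast : ℤ → F) h3
  simpa [FiniteField.cast_card_eq_zero] using h4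

open scoped Classical in
/-- The number of points at square distance from `n - 1` given points. -/
theorem card_common_square_neighbors (hF : (2 : F) ≠ 0) (hn : Fintype.card ι + 2 = n)
    (x₀ : Fin n → F) (x : ι → Fin n → F) :
    ((Finset.univ.filter fun u : Fin n → F => IsSquare ((u - x₀) ⬝ᵥ (u - x₀)) ∧
      ∀ i, IsSquare ((u - x i) ⬝ᵥ (u - x i))).card : F) =
      ((Finset.univ.filter fun a : F => IsSquare a).card : F) ^ (Fintype.card ι + 1) *
        isotropicCount fun i => x i - x₀ := by
  set sq := Finset.univ.filter fun a : F => IsSquare a with hsq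
  rw [Finset.card_eq_sum_card_fiberwise
    (f := fun u => ((u - x₀) ⬝ᵥ (u - x₀), fun i => (u - x i) ⬝ᵥ (u - x i)))
    (t := sq ×ˢ Fintype.piFinset fun _ : ι => sq)]
  · rw [Nat.cast_sum, Finset.sum_congr rfl (g := fun _ => isotropicCount fun i => x i - x₀)]
    · simp [Fintype.card_piFinset, Finset.card_product, pow_succ']
    · rintro ⟨t, c⟩ htc
      simp only [hsq, Finset.mem_product, Fintype.mem_piFinset, Finset.mem_filter,
        Finset.mem_univ, true_and] at htc
      rw [← card_quadric_inter_eq_isotropicCount hn (fun i => x i - x₀) t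
        fun i => (t + (x i - x₀) ⬝ᵥ (x i - x₀) - c i) / 2]
      congr 1
      refine Finset.card_bij' (fun u _ => u - x₀) (fun u _ => u + x₀) ?_ ?_
        (fun _ _ => sub_add_cancel _ _) (fun _ _ => add_sub_cancel_right _ _)
      · intro u hu
        simp only [Finset.mem_filter, Finset.mem_univ, true_and, Prod.mk.injEq] at hu ⊢
        refine ⟨hu.2.1, fun i => ?_⟩
        have h1 := hu.2.1
        have h2 := congrFun hu.2.2 i
        rw [← h1, ← h2, eq_div_iff hF]
        simp only [sub_dotProduct, dotProduct_sub, dotProduct_comm x₀ u, dotProduct_comm (x i) u,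
          dotProduct_comm x₀ (x i)]
        ring
      · intro u hu
        simp only [Finset.mem_filter, Finset.mem_univ, true_and, Prod.mk.injEq,
          add_sub_cancel_right] at hu ⊢
        have h2 : ∀ i, (u + x₀ - x i) ⬝ᵥ (u + x₀ - x i) = c i := by
          intro i
          have h := hu.2 i
          rw [← hu.1, eq_div_iff hF] at h
          simp only [sub_dotProduct, dotProduct_sub, add_dotProduct, dotProduct_add,
            dotProduct_comm x₀ u, dotProduct_comm (x i) u, dotProduct_comm x₀ (x i)] at h ⊢
          linear_combination -h
        exact ⟨⟨hu.1 ▸ htc.1, fun i => (h2 i) ▸ htc.2 i⟩, hu.1, funext h2⟩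
  · intro u hu
    simpa [hsq] using hu

/-- Permutations preserving square distances preserve `isotropicCount`. -/
theorem isotropicCount_map (hF : (2 : F) ≠ 0) (hn : Fintype.card ι + 2 = n)
    (γ : Equiv.Perm (Fin n → F))
    (hγ : ∀ x y, IsSquare ((x - y) ⬝ᵥ (x - y)) ↔ IsSquare ((γ x - γ y) ⬝ᵥ (γ x - γ y)))
    (x₀ : Fin n → F) (x : ι → Fin n → F) :
    isotropicCount (fun i => γ (x i) - γ x₀) = isotropicCount fun i => x i - x₀ := by
  classical
  have hsq : ((Finset.univ.filter fun a : F => IsSquare a).card : F) ^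
      (Fintype.card ι + 1) ≠ 0 := by
    refine pow_ne_zero _ fun h => ?_
    have := two_mul_card_squares hF
    rw [h, mul_zero] at this
    exact zero_ne_one this
  refine mul_left_cancel₀ hsq ?_
  rw [← card_common_square_neighbors hF hn, ← card_common_square_neighbors hF hn]
  congr 1
  symm
  refine Finset.card_bij' (fun u _ => γ u) (fun u _ => γ.symm u) ?_ ?_ (by simp) (by simp)
  · intro u hu
    simpa only [Finset.mem_filter, Finset.mem_univ, true_and, ← hγ] using hu
  · intro u hu
    simpa only [Finset.mem_filter, Finset.mem_univ, true_and, hγ (γ.symm u),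
      γ.apply_symm_apply] using hu

end Counting

section Counting

variable {F : Type*} [Field F] [Fintype F] {n : ℕ} {ι : Type*}

/-- An isotropic vector in the radical of the orthogonal complement acts freely by translation on
the isotropic vectors of that complement. -/
theorem isotropicCount_eq_zero {v : ι → Fin n → F} {w : Fin n → F} (hw : w ≠ 0)
    (hww : w ⬝ᵥ w = 0) (hwv : ∀ i, w ⬝ᵥ v i = 0)
    (hrad : ∀ u : Fin n → F, (∀ i, u ⬝ᵥ v i = 0) → u ⬝ᵥ w = 0) : isotropicCount v = 0 := by
  classical
  obtain ⟨p, hp⟩ := CharP.exists F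
  have : Fact p.Prime := ⟨CharP.char_is_prime F p⟩
  rw [isotropicCount, CharP.cast_eq_zero_iff F p, ← Fintype.card_coe]
  set S := Finset.univ.filter fun u : Fin n → F => u ⬝ᵥ u = 0 ∧ ∀ i, u ⬝ᵥ v i = 0 with hS
  have hmem : ∀ u ∈ S, u + w ∈ S := by
    intro u hu
    simp only [hS, Finset.mem_filter, Finset.mem_univ, true_and] at hu ⊢
    have h := hrad u hu.2
    refine ⟨?_, fun i => by rw [add_dotProduct, hu.2 i, hwv i, add_zero]⟩
    rw [add_dotProduct, dotProduct_add, dotProduct_add, dotProduct_comm w u, hu.1, hww, h]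
    simp
  let f : Function.End S := fun u => ⟨u + w, hmem u u.2⟩
  have hf : ∀ (k : ℕ) (u : S), ((f ^ k) u : Fin n → F) = u + k • w := by
    intro k
    induction k with
    | zero =>
      intro u
      rw [pow_zero, zero_smul, add_zero]
      rfl
    | succ k ih =>
      intro u
      rw [pow_succ]
      refine (ih (f u)).trans ?_
      simp only [f, succ_nsmul]
      abel
  have hfp : f ^ p ^ 1 = 1 := by
    funext u
    apply Subtype.ext
    rw [hf, pow_one]
    have : p • w = 0 := by
      funext j
      simp
    rw [this, add_zero]
    rfl
  have := Equiv.Perm.card_fixedPoints_modEq hfp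
  have hempty : IsEmpty (Function.fixedPoints f) := by
    refine ⟨fun u => hw ?_⟩
    have h := congrArg Subtype.val u.2
    simpa [f] using h
  rw [Fintype.card_eq_zero (α := Function.fixedPoints f)] at this
  exact (Nat.modEq_zero_iff_dvd).1 this

/-- A nondegenerate plane contains, modulo the characteristic, one or minus one isotropic
vectors. -/
theorem isotropicCount_ne_zero (hF : (2 : F) ≠ 0) {v : ι → Fin n → F} {a c : Fin n → F}
    (ha : a ⬝ᵥ a ≠ 0) (hc : c ⬝ᵥ c ≠ 0) (hac : a ⬝ᵥ c = 0)
    (hv : ∀ u : Fin n → F, (∀ i, u ⬝ᵥ v i = 0) ↔ ∃ r s : F, u = r • a + s • c) :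
    isotropicCount v ≠ 0 := by
  classical
  have hca : c ⬝ᵥ a = 0 := by rw [dotProduct_comm, hac]
  set d : F := -(a ⬝ᵥ a) / (c ⬝ᵥ c) with hd
  have hd0 : d ≠ 0 := div_ne_zero (neg_ne_zero.2 ha) hc
  have hQ : ∀ r s : F, (r • a + s • c) ⬝ᵥ (r • a + s • c) = 0 ↔ s ^ 2 = d * r ^ 2 := by
    intro r s
    simp only [add_dotProduct, dotProduct_add, smul_dotProduct, dotProduct_smul, hac, hca,
      smul_eq_mul, hd]
    rw [div_mul_eq_mul_div, eq_div_iff hc]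
    constructor <;> intro h <;> linear_combination h
  have hcard : (Finset.univ.filter fun u : Fin n → F => u ⬝ᵥ u = 0 ∧ ∀ i, u ⬝ᵥ v i = 0).card =
      (Finset.univ.filter fun x : F × F => x.2 ^ 2 = d * x.1 ^ 2).card := by
    symm
    refine Finset.card_bij (fun x _ => x.1 • a + x.2 • c) ?_ ?_ ?_
    · intro x hx
      simp only [Finset.mem_filter, Finset.mem_univ, true_and] at hx ⊢
      exact ⟨(hQ _ _).2 hx, (hv _).2 ⟨_, _, rfl⟩⟩
    · intro x _ y _ h
      have h1 := congrArg (· ⬝ᵥ a) h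
      have h2 := congrArg (· ⬝ᵥ c) h
      simp only [add_dotProduct, smul_dotProduct, hac, hca, smul_eq_mul, mul_zero, add_zero,
        zero_add] at h1 h2
      exact Prod.ext (mul_right_cancel₀ ha h1) (mul_right_cancel₀ hc h2)
    · intro u hu
      simp only [Finset.mem_filter, Finset.mem_univ, true_and] at hu
      obtain ⟨r, s, rfl⟩ := (hv u).1 hu.2
      exact ⟨(r, s), by simpa using (hQ r s).1 hu.1, rfl⟩
  have hfib : ∀ r : F, ((Finset.univ.filter fun s : F => s ^ 2 = d * r ^ 2).card : ℤ) =
      if r = 0 then 1 else quadraticChar F d + 1 := by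
    intro r
    have h := quadraticChar_card_sqrts (two_ne_zero_iff_ringChar.1 hF) (d * r ^ 2)
    rw [Set.toFinset_ofPred] at h
    rw [h]
    split_ifs with hr
    · simp [hr]
    · rw [map_mul, quadraticChar_sq_one' hr, mul_one]
  have htot : ((Finset.univ.filter fun x : F × F => x.2 ^ 2 = d * x.1 ^ 2).card : ℤ) =
      1 + (Fintype.card F - 1) * (quadraticChar F d + 1) := by
    rw [Finset.card_filter, Fintype.sum_prod_type]
    simp only [← Finset.card_filter]
    rw [Nat.cast_sum, Finset.sum_congr rfl fun r _ => hfib r, Finset.sum_ite,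
      Finset.sum_const, Finset.sum_const, Finset.filter_eq' _ (0 : F),
      Finset.filter_ne' _ (0 : F), Finset.card_erase_of_mem (Finset.mem_univ _),
      Finset.card_univ]
    have := Fintype.card_pos (α := F)
    simp [Nat.cast_sub (Nat.one_le_iff_ne_zero.2 this.ne')]
  have hF' := congrArg (Int.cast : ℤ → F) htot
  push_cast at hF'
  rw [FiniteField.cast_card_eq_zero] at hF'
  rw [isotropicCount, hcard, hF']
  rcases quadraticChar_dichotomy hd0 with h | h <;> rw [h] <;> norm_num

end Counting

section Orthogonality

variable {F : Type*} [Field F] {n : ℕ}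

/-- `S` is an orthogonal direct summand of the standard quadratic space. -/
def HasOrthogonalProjection (S : Submodule F (Fin n → F)) : Prop :=
  ∀ x, ∃ s ∈ S, ∀ t ∈ S, (x - s) ⬝ᵥ t = 0

theorem HasOrthogonalProjection.sup_span {S : Submodule F (Fin n → F)}
    (hS : HasOrthogonalProjection S) {a : Fin n → F} (ha : ∀ t ∈ S, a ⬝ᵥ t = 0)
    (haa : a ⬝ᵥ a ≠ 0) : HasOrthogonalProjection (S ⊔ Submodule.span F {a}) := by
  intro x
  obtain ⟨s, hs, h⟩ := hS x
  refine ⟨s + (x ⬝ᵥ a / a ⬝ᵥ a) • a, Submodule.add_mem_sup hs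
    (Submodule.smul_mem _ _ (Submodule.mem_span_singleton_self a)), fun t ht => ?_⟩
  obtain ⟨t₁, ht₁, t₂, ht₂, rfl⟩ := Submodule.mem_sup.1 ht
  obtain ⟨r, rfl⟩ := Submodule.mem_span_singleton.1 ht₂
  have h1 := h t₁ ht₁
  have h2 := ha t₁ ht₁
  have h3 : s ⬝ᵥ a = 0 := by rw [dotProduct_comm, ha s hs]
  rw [sub_dotProduct] at h1
  simp only [sub_dotProduct, dotProduct_add, add_dotProduct, smul_dotProduct, dotProduct_smul,
    smul_eq_mul, h2, h3]
  rw [div_mul_cancel₀ _ haa]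
  linear_combination h1

theorem hasOrthogonalProjection_bot :
    HasOrthogonalProjection (⊥ : Submodule F (Fin n → F)) := fun x =>
  ⟨0, Submodule.zero_mem _, fun t ht => by rw [(Submodule.mem_bot F).1 ht, dotProduct_zero]⟩

theorem HasOrthogonalProjection.exists_ne_zero {S : Submodule F (Fin n → F)} (hF : (2 : F) ≠ 0)
    (hS : HasOrthogonalProjection S) (htop : Module.finrank F S < n) :
    ∃ a : Fin n → F, (∀ t ∈ S, a ⬝ᵥ t = 0) ∧ a ⬝ᵥ a ≠ 0 := by
  have hne : S ≠ ⊤ := by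
    rintro rfl
    simp at htop
  obtain ⟨x, -, hx⟩ := SetLike.exists_of_lt (lt_top_iff_ne_top.2 hne)
  obtain ⟨s, hs, h⟩ := hS x
  have hy : x - s ≠ 0 := fun h0 => hx (sub_eq_zero.1 h0 ▸ hs)
  obtain ⟨u, hu⟩ : ∃ u, (x - s) ⬝ᵥ u ≠ 0 := by
    by_contra! hcon
    exact hy (dotProduct_eq_zero _ hcon)
  obtain ⟨s', hs', h'⟩ := hS u
  set y := x - s
  set u' := u - s' with hu'
  have hyu : y ⬝ᵥ u' ≠ 0 := by rwa [hu', dotProduct_sub, h s' hs', sub_zero]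
  by_contra! hcon
  have h1 := hcon y h
  have h2 := hcon u' h'
  have h3 := hcon (y + u') fun t ht => by rw [add_dotProduct, h t ht, h' t ht, add_zero]
  rw [add_dotProduct, dotProduct_add, dotProduct_add, h1, h2, dotProduct_comm u' y] at h3
  exact mul_ne_zero hF hyu (by linear_combination h3)

theorem finrank_sup_span_singleton_le (S : Submodule F (Fin n → F)) (a : Fin n → F) :
    Module.finrank F (S ⊔ Submodule.span F {a} : Submodule F (Fin n → F)) ≤
      Module.finrank F S + 1 := by
  have h : Module.finrank F (Submodule.span F {a}) ≤ 1 := by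
    simpa using finrank_span_le_card (R := F) ({a} : Set (Fin n → F))
  exact (Submodule.finrank_add_le_finrank_add_finrank _ _).trans (Nat.add_le_add_left h _)

theorem HasOrthogonalProjection.exists_pair {S : Submodule F (Fin n → F)} (hF : (2 : F) ≠ 0)
    (hS : HasOrthogonalProjection S) (htop : Module.finrank F S + 1 < n) :
    ∃ a c : Fin n → F, (∀ t ∈ S, a ⬝ᵥ t = 0) ∧ (∀ t ∈ S, c ⬝ᵥ t = 0) ∧ a ⬝ᵥ a ≠ 0 ∧
      c ⬝ᵥ c ≠ 0 ∧ a ⬝ᵥ c = 0 := by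
  obtain ⟨a, ha, haa⟩ := hS.exists_ne_zero hF (by omega)
  obtain ⟨c, hc, hcc⟩ := (hS.sup_span ha haa).exists_ne_zero hF
    ((finrank_sup_span_singleton_le S a).trans_lt htop)
  refine ⟨a, c, ha, fun t ht => hc t (Submodule.mem_sup_left ht), haa, hcc, ?_⟩
  rw [dotProduct_comm]
  exact hc a (Submodule.mem_sup_right (Submodule.mem_span_singleton_self a))

theorem hasOrthogonalProjection_span_pair {v w : Fin n → F} (hv : v ⬝ᵥ v = 0)
    (hvw : v ⬝ᵥ w ≠ 0) : HasOrthogonalProjection (Submodule.span F {v, w}) := by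
  intro x
  refine ⟨((x ⬝ᵥ w - x ⬝ᵥ v / v ⬝ᵥ w * w ⬝ᵥ w) / v ⬝ᵥ w) • v + (x ⬝ᵥ v / v ⬝ᵥ w) • w,
    Submodule.mem_span_pair.2 ⟨_, _, rfl⟩, fun t ht => ?_⟩
  obtain ⟨r, s, rfl⟩ := Submodule.mem_span_pair.1 ht
  simp only [sub_dotProduct, dotProduct_add, add_dotProduct, smul_dotProduct, dotProduct_smul,
    smul_eq_mul, hv, dotProduct_comm w v]
  field_simp
  ring

theorem exists_dotProduct_ne_zero {v : Fin n → F} (hv : v ≠ 0) : ∃ w, v ⬝ᵥ w ≠ 0 := by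
  by_contra! hcon
  exact hv (dotProduct_eq_zero _ hcon)

theorem exists_smul_eq_of_orthogonal_le {v w : Fin n → F}
    (h : ∀ x, x ⬝ᵥ v = 0 → x ⬝ᵥ w = 0) : ∃ r : F, w = r • v := by
  by_cases hv : v = 0
  · refine ⟨0, ?_⟩
    rw [zero_smul]
    exact dotProduct_eq_zero _ fun x => by
      rw [dotProduct_comm]
      exact h x (by rw [hv, dotProduct_zero])
  · obtain ⟨y, hy⟩ := exists_dotProduct_ne_zero hv
    refine ⟨w ⬝ᵥ y / v ⬝ᵥ y, dotProduct_eq _ _ fun x => ?_⟩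
    have := h (x - (x ⬝ᵥ v / v ⬝ᵥ y) • y) (by
      rw [sub_dotProduct, smul_dotProduct, smul_eq_mul, dotProduct_comm y, div_mul_cancel₀ _ hy,
        sub_self])
    rw [sub_dotProduct, smul_dotProduct, smul_eq_mul, sub_eq_zero] at this
    rw [dotProduct_comm, this, smul_dotProduct, smul_eq_mul, dotProduct_comm v x,
      dotProduct_comm w y]
    ring

/-- A vector not orthogonal to an isotropic vector `v` can be moved along `v` to an isotropic
vector. -/
theorem exists_isotropic_add_smul (hF : (2 : F) ≠ 0) {v x : Fin n → F} (hv : v ⬝ᵥ v = 0)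
    (hx : v ⬝ᵥ x ≠ 0) : ∃ r : F, (x + r • v) ⬝ᵥ (x + r • v) = 0 := by
  refine ⟨-(x ⬝ᵥ x) / (2 * v ⬝ᵥ x), ?_⟩
  simp only [dotProduct_add, add_dotProduct, smul_dotProduct, dotProduct_smul, smul_eq_mul, hv,
    dotProduct_comm x v]
  field_simp
  ring

theorem finrank_span_pair_le (v w : Fin n → F) :
    Module.finrank F (Submodule.span F {v, w}) ≤ 2 := by
  classical
  exact (finrank_span_le_card {v, w}).trans (by simpa using Finset.card_le_two)

/-- Every point sees some point of a line with anisotropic direction of square length. -/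
theorem exists_isSquare_sub_smul (hF : (2 : F) ≠ 0) {v : Fin n → F} (hv : v ⬝ᵥ v ≠ 0)
    (hsq : IsSquare (v ⬝ᵥ v)) (z : Fin n → F) :
    ∃ r : F, IsSquare ((z - r • v) ⬝ᵥ (z - r • v)) := by
  obtain ⟨s, hs⟩ := hsq
  have hs0 : s ≠ 0 := by rintro rfl; exact hv (by simpa using hs)
  set κ := z ⬝ᵥ z - (z ⬝ᵥ v) ^ 2 / (v ⬝ᵥ v) with hκ
  refine ⟨z ⬝ᵥ v / v ⬝ᵥ v - (κ - 1) / (2 * s), (κ + 1) / 2, ?_⟩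
  simp only [dotProduct_sub, sub_dotProduct, smul_dotProduct, dotProduct_smul, smul_eq_mul,
    dotProduct_comm v z]
  have : z ⬝ᵥ z = κ + (z ⬝ᵥ v) ^ 2 / (v ⬝ᵥ v) := by rw [hκ]; ring
  rw [this, hs]
  field_simp
  ring

end Orthogonality

section Isotropy

variable {F : Type*} [Field F] [Fintype F] {m : ℕ}

/-- A nonzero vector orthogonal to the nondegenerate plane spanned by `a` and `c` extends to a
family spanning the orthogonal complement of that plane. -/
theorem exists_isotropicCount_cons_ne_zero (hF : (2 : F) ≠ 0) {v a c y : Fin (m + 3) → F}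
    (ha : a ⬝ᵥ a ≠ 0) (hc : c ⬝ᵥ c ≠ 0) (hac : a ⬝ᵥ c = 0) (hva : v ⬝ᵥ a = 0)
    (hvc : v ⬝ᵥ c = 0) (hvy : v ⬝ᵥ y ≠ 0) :
    ∃ U : Fin m → Fin (m + 3) → F, (∀ i, U i ⬝ᵥ a = 0 ∧ U i ⬝ᵥ c = 0 ∧ U i ⬝ᵥ y = 0) ∧
      isotropicCount (Fin.cons v U : Fin (m + 1) → Fin (m + 3) → F) ≠ 0 := by
  have hca : c ⬝ᵥ a = 0 := by rw [dotProduct_comm, hac]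
  let φ : (Fin (m + 3) → F) →ₗ[F] F × F × F :=
    { toFun := fun x => (x ⬝ᵥ a, x ⬝ᵥ c, x ⬝ᵥ y)
      map_add' := fun x x' => by simp
      map_smul' := fun r x => by simp }
  have hφ : ∀ t : F × F × F, ∃ α β γ : F, φ (α • a + β • c + γ • v) = t := by
    intro t
    refine ⟨t.1 / a ⬝ᵥ a, t.2.1 / c ⬝ᵥ c,
      (t.2.2 - t.1 / a ⬝ᵥ a * a ⬝ᵥ y - t.2.1 / c ⬝ᵥ c * c ⬝ᵥ y) / v ⬝ᵥ y, ?_⟩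
    simp only [φ, LinearMap.coe_mk, AddHom.coe_mk, add_dotProduct, smul_dotProduct, smul_eq_mul,
      hac, hca, hva, hvc, mul_zero, add_zero, zero_add, div_mul_cancel₀ _ ha,
      div_mul_cancel₀ _ hc, div_mul_cancel₀ _ hvy]
    refine Prod.ext rfl (Prod.ext rfl ?_)
    dsimp only
    ring
  have hsurj : LinearMap.range φ = ⊤ := LinearMap.range_eq_top.2 fun t =>
    let ⟨_, _, _, h⟩ := hφ t
    ⟨_, h⟩
  have hker : Module.finrank F (LinearMap.ker φ) = m := by
    have := LinearMap.finrank_range_add_finrank_ker φ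
    rw [hsurj, finrank_top] at this
    simp at this
    omega
  let B := Module.finBasisOfFinrankEq F (LinearMap.ker φ) hker
  have hB : ∀ u : Fin (m + 3) → F, (∀ i, u ⬝ᵥ (B i : Fin (m + 3) → F) = 0) →
      ∀ x ∈ LinearMap.ker φ, u ⬝ᵥ x = 0 := by
    intro u hu x hx
    have := congrArg Subtype.val (B.sum_repr ⟨x, hx⟩)
    rw [← show _ = x from this, Submodule.coe_sum, dotProduct_sum]
    simp [hu]
  have hmem : ∀ x ∈ LinearMap.ker φ, x ⬝ᵥ a = 0 ∧ x ⬝ᵥ c = 0 ∧ x ⬝ᵥ y = 0 := by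
    intro x hx
    simpa [φ] using hx
  refine ⟨fun i => B i, fun i => hmem _ (B i).2, isotropicCount_ne_zero hF ha hc hac fun u => ?_⟩
  rw [Fin.forall_fin_succ]
  simp only [Fin.cons_zero, Fin.cons_succ]
  constructor
  · rintro ⟨huv, huB⟩
    refine ⟨u ⬝ᵥ a / a ⬝ᵥ a, u ⬝ᵥ c / c ⬝ᵥ c, dotProduct_eq _ _ fun x => ?_⟩
    obtain ⟨α, β, γ, h⟩ := hφ (φ x)
    have hk : x - (α • a + β • c + γ • v) ∈ LinearMap.ker φ := by
      rw [LinearMap.mem_ker, map_sub, h, sub_self]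
    have h1 := hB u huB _ hk
    obtain ⟨h2, h3, -⟩ := hmem _ hk
    simp only [sub_dotProduct, dotProduct_sub, add_dotProduct, dotProduct_add, smul_dotProduct,
      dotProduct_smul, smul_eq_mul, hac, hca, hva, hvc, huv] at h1 h2 h3 ⊢
    rw [dotProduct_comm a x, dotProduct_comm c x, sub_eq_zero.1 h1, sub_eq_zero.1 h2,
      sub_eq_zero.1 h3]
    field_simp
    ring
  · rintro ⟨r, s, rfl⟩
    constructor
    · simp [dotProduct_comm _ v, hva, hvc]
    · intro i
      obtain ⟨h1, h2, -⟩ := hmem _ (B i).2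
      simp [dotProduct_comm _ (B i : Fin (m + 3) → F), h1, h2]

theorem isotropicCount_cons_eq_zero {v : Fin (m + 3) → F} (hv : v ≠ 0) (hvv : v ⬝ᵥ v = 0)
    {U : Fin m → Fin (m + 3) → F} (hU : ∀ i, U i ⬝ᵥ v = 0) :
    isotropicCount (Fin.cons v U : Fin (m + 1) → Fin (m + 3) → F) = 0 := by
  refine isotropicCount_eq_zero hv hvv ?_ fun u hu => hu 0
  rw [Fin.forall_fin_succ]
  exact ⟨hvv, fun i => by rw [Fin.cons_succ, dotProduct_comm, hU]⟩

theorem isotropicCount_cons_smul {r : F} (hr : r ≠ 0) (v : Fin (m + 3) → F)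
    (U : Fin m → Fin (m + 3) → F) :
    isotropicCount (Fin.cons (r • v) U : Fin (m + 1) → Fin (m + 3) → F) =
      isotropicCount (Fin.cons v U : Fin (m + 1) → Fin (m + 3) → F) := by
  rw [isotropicCount, isotropicCount]
  congr 2
  ext u
  simp [Fin.forall_fin_succ, hr]

/-- Outside the line of an isotropic vector `v`, every vector is distinguished from `v` by
some `isotropicCount`. -/
theorem exists_isotropicCount_separating (hF : (2 : F) ≠ 0) (hm : m ≠ 0)
    {v w : Fin (m + 3) → F} (hv : v ≠ 0) (hvv : v ⬝ᵥ v = 0) (hw : ∀ r : F, w ≠ r • v) :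
    ∃ U : Fin m → Fin (m + 3) → F, (∀ i, U i ⬝ᵥ v = 0) ∧
      isotropicCount (Fin.cons w U : Fin (m + 1) → Fin (m + 3) → F) ≠ 0 := by
  by_cases hvw : v ⬝ᵥ w = 0
  · have hw0 : w ≠ 0 := by simpa using hw 0
    obtain ⟨x, hxw, hxv⟩ : ∃ x, x ⬝ᵥ w = 0 ∧ x ⬝ᵥ v ≠ 0 := by
      by_contra! hcon
      obtain ⟨r, hr⟩ := exists_smul_eq_of_orthogonal_le hcon
      have hr0 : r ≠ 0 := by rintro rfl; exact hv (by simpa using hr)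
      exact hw r⁻¹ (by rw [hr, smul_smul, inv_mul_cancel₀ hr0, one_smul])
    obtain ⟨y, hy⟩ := exists_dotProduct_ne_zero hw0
    rw [dotProduct_comm] at hxv
    obtain ⟨r, hr⟩ := exists_isotropic_add_smul hF hvv hxv
    set x' := x + r • v with hx'
    have hvx' : v ⬝ᵥ x' ≠ 0 := by simpa [hx', hvv] using hxv
    have hwx' : w ⬝ᵥ x' = 0 := by
      rw [hx', dotProduct_add, dotProduct_smul, dotProduct_comm w v, hvw, dotProduct_comm w x,
        hxw]
      simp
    have hwv : w ⬝ᵥ v = 0 := by rw [dotProduct_comm, hvw]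
    obtain ⟨U, hU, hcount⟩ := exists_isotropicCount_cons_ne_zero hF (v := w) (a := v + x')
      (c := v - x') (y := y)
      (by
        simp only [dotProduct_add, add_dotProduct, hvv, hr, dotProduct_comm x' v]
        simpa [← two_mul] using ⟨hF, hvx'⟩)
      (by
        simp only [dotProduct_sub, sub_dotProduct, hvv, hr, dotProduct_comm x' v]
        intro h
        exact mul_ne_zero hF hvx' (by linear_combination -h))
      (by
        simp only [dotProduct_sub, add_dotProduct, hvv, hr, dotProduct_comm x' v]
        ring)
      (by rw [dotProduct_add, hwv, hwx', add_zero]) (by rw [dotProduct_sub, hwv, hwx', sub_zero])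
      hy
    refine ⟨U, fun i => ?_, hcount⟩
    obtain ⟨h1, h2, -⟩ := hU i
    rw [dotProduct_add] at h1
    rw [dotProduct_sub] at h2
    exact (mul_eq_zero.1 (show 2 * U i ⬝ᵥ v = 0 by linear_combination h1 + h2)).resolve_left hF
  · have hle := finrank_span_pair_le v w
    obtain ⟨a, c, ha, hc, haa, hcc, hac⟩ :=
      (hasOrthogonalProjection_span_pair hvv hvw).exists_pair hF (by omega)
    have hmem := Submodule.subset_span (R := F) (s := {v, w}) (Set.mem_insert_of_mem v rfl)
    obtain ⟨U, hU, hcount⟩ := exists_isotropicCount_cons_ne_zero hF haa hcc hac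
      (by rw [dotProduct_comm, ha w hmem]) (by rw [dotProduct_comm, hc w hmem])
      (show w ⬝ᵥ v ≠ 0 by rwa [dotProduct_comm])
    exact ⟨U, fun i => (hU i).2.2, hcount⟩

theorem exists_orthogonal_not_isSquare (hF : (2 : F) ≠ 0) (hm : m ≠ 0) {v : Fin (m + 3) → F}
    (hv : v ≠ 0) (hvv : v ⬝ᵥ v = 0) : ∃ z, z ⬝ᵥ v = 0 ∧ ¬IsSquare (z ⬝ᵥ z) := by
  have hchar := two_ne_zero_iff_ringChar.1 hF
  obtain ⟨w, hvw⟩ := exists_dotProduct_ne_zero hv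
  have hle := finrank_span_pair_le v w
  obtain ⟨a, c, ha, hc, haa, hcc, hac⟩ :=
    (hasOrthogonalProjection_span_pair hvv hvw).exists_pair hF (by omega)
  have hmem := Submodule.subset_span (R := F) (s := {v, w}) (Set.mem_insert v _)
  obtain ⟨ν, hν⟩ := FiniteField.exists_nonsquare hchar
  obtain ⟨α, β, h⟩ := FiniteField.exists_root_sum_quadratic
    (f := Polynomial.C (a ⬝ᵥ a) * Polynomial.X ^ 2)
    (g := Polynomial.C (c ⬝ᵥ c) * Polynomial.X ^ 2 + Polynomial.C 0 * Polynomial.X +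
      Polynomial.C (-ν))
    (Polynomial.degree_C_mul_X_pow 2 haa) (Polynomial.degree_quadratic hcc)
    (FiniteField.odd_card_of_char_ne_two hchar)
  refine ⟨α • a + β • c, by simp [ha v hmem, hc v hmem], ?_⟩
  convert hν using 2
  simp only [Polynomial.eval_add, Polynomial.eval_mul, Polynomial.eval_C, Polynomial.eval_pow,
    Polynomial.eval_X] at h
  simp only [dotProduct_add, add_dotProduct, smul_dotProduct, dotProduct_smul, smul_eq_mul, hac,
    dotProduct_comm c a]
  linear_combination h

/-- Integral automorphisms preserve isotropy of differences. -/
theorem isotropic_map (hF : (2 : F) ≠ 0) (γ : Equiv.Perm (Fin (m + 3) → F))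
    (hγ : ∀ x y, IsSquare ((x - y) ⬝ᵥ (x - y)) ↔ IsSquare ((γ x - γ y) ⬝ᵥ (γ x - γ y)))
    (x y : Fin (m + 3) → F) (hxy : (x - y) ⬝ᵥ (x - y) = 0) :
    (γ x - γ y) ⬝ᵥ (γ x - γ y) = 0 := by
  by_cases hne : x = y
  · simp [hne]
  have hv : x - y ≠ 0 := sub_ne_zero.2 hne
  have hcount : ∀ (w : Fin (m + 3) → F) (U : Fin m → Fin (m + 3) → F),
      isotropicCount (Fin.cons (γ w - γ y) fun i => γ (y + U i) - γ y :
        Fin (m + 1) → Fin (m + 3) → F) =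
      isotropicCount (Fin.cons (w - y) U : Fin (m + 1) → Fin (m + 3) → F) := by
    intro w U
    have := isotropicCount_map hF (by simp) γ hγ y
      (Fin.cons w (fun i => y + U i) : Fin (m + 1) → Fin (m + 3) → F)
    convert this using 2
    · funext i
      refine Fin.cases ?_ (fun i => ?_) i <;> simp
    · funext i
      refine Fin.cases ?_ (fun i => ?_) i <;> simp
  by_contra hv'
  by_cases hm : m = 0
  · subst hm
    have hproj := hasOrthogonalProjection_bot.sup_span (fun t ht => by
      rw [(Submodule.mem_bot F).1 ht, dotProduct_zero]) hv'
    have hle : Module.finrank F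
        (⊥ ⊔ Submodule.span F {γ x - γ y} : Submodule F (Fin (0 + 3) → F)) ≤ 1 := by
      rw [bot_sup_eq]
      exact (finrank_span_le_card {γ x - γ y}).trans (by simp)
    obtain ⟨a, c, ha, hc, haa, hcc, hac⟩ := hproj.exists_pair hF (by omega)
    have hmem : γ x - γ y ∈ (⊥ ⊔ Submodule.span F {γ x - γ y} : Submodule F (Fin (0 + 3) → F)) :=
      Submodule.mem_sup_right (Submodule.mem_span_singleton_self _)
    obtain ⟨U, -, h⟩ := exists_isotropicCount_cons_ne_zero hF haa hcc hac
      (by rw [dotProduct_comm, ha _ hmem]) (by rw [dotProduct_comm, hc _ hmem]) hv'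
    rw [Subsingleton.elim U fun i => γ (y + U i) - γ y, hcount] at h
    exact h (isotropicCount_cons_eq_zero hv hxy fun i => i.elim0)
  · obtain ⟨z, hzv, hz⟩ := exists_orthogonal_not_isSquare hF hm hv hxy
    obtain ⟨r, hr⟩ := exists_isSquare_sub_smul hF hv'
      ((hγ x y).1 (by rw [hxy]; exact IsSquare.zero)) (γ (y + z) - γ y)
    obtain ⟨w, hw⟩ := γ.surjective (γ y + r • (γ x - γ y))
    rw [sub_sub, ← hw, ← hγ] at hr
    obtain ⟨s, hs⟩ : ∃ s : F, w - y = s • (x - y) := by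
      by_contra! hcon
      obtain ⟨U, hU, h⟩ := exists_isotropicCount_separating hF hm hv hxy hcon
      have hr0 : r ≠ 0 := by
        rintro rfl
        rw [zero_smul, add_zero] at hw
        exact hcon 0 (by rw [γ.injective hw, sub_self, zero_smul])
      rw [← hcount, hw, add_sub_cancel_left, isotropicCount_cons_smul hr0, hcount] at h
      exact h (isotropicCount_cons_eq_zero hv hxy hU)
    have : y + z - w = z - s • (x - y) := by rw [← hs]; abel
    rw [this] at hr
    refine hz ?_
    convert hr using 1
    clear hs this hw hr hv' hv
    generalize x - y = d at hxy hzv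
    simp only [sub_dotProduct, dotProduct_sub, smul_dotProduct, dotProduct_smul,
      dotProduct_comm d z, hxy, hzv]
    simp

end Isotropy

section Additivity

variable {F : Type*} [Field F] {n : ℕ}

/-- The line through `x` with isotropic direction `v` consists of the points that are
joined isotropically to everything joined isotropically to both `x` and `x + v`. -/
theorem mem_isotropic_line_iff (hF : (2 : F) ≠ 0) {v : Fin n → F} (hvv : v ⬝ᵥ v = 0)
    (x w : Fin n → F) :
    (∃ r : F, w = x + r • v) ↔ ∀ z, (z - x) ⬝ᵥ (z - x) = 0 →
      (z - (x + v)) ⬝ᵥ (z - (x + v)) = 0 → (w - z) ⬝ᵥ (w - z) = 0 := by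
  have hsub : ∀ z : Fin n → F, (z - (x + v)) ⬝ᵥ (z - (x + v)) =
      (z - x) ⬝ᵥ (z - x) - 2 * (z - x) ⬝ᵥ v := by
    intro z
    rw [← sub_sub]
    generalize z - x = d
    simp only [sub_dotProduct, dotProduct_sub, hvv, dotProduct_comm v d]
    ring
  constructor
  · rintro ⟨r, rfl⟩ z h1 h2
    rw [hsub, h1, zero_sub, neg_eq_zero] at h2
    have h3 := (mul_eq_zero.1 h2).resolve_left hF
    rw [show x + r • v - z = r • v - (z - x) by abel]
    generalize z - x = d at h1 h3
    simp [sub_dotProduct, dotProduct_sub, hvv, dotProduct_comm v d, h1, h3]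
  · intro h
    have h1 := h x (by simp) (by simp [hvv])
    have h2 := h (x + v) (by simp [hvv]) (by simp)
    have hx : ∀ y : Fin n → F, y ⬝ᵥ y = 0 → y ⬝ᵥ v = 0 → (w - x) ⬝ᵥ y = 0 := by
      intro y hy hyv
      have h3 := h (x + y) (by simp [hy]) (by rw [hsub]; simp [hy, hyv])
      rw [← sub_sub] at h3
      generalize w - x = d at h1 h3 ⊢
      simp only [sub_dotProduct, dotProduct_sub, h1, hy, dotProduct_comm y d] at h3
      exact (mul_eq_zero.1 (show 2 * d ⬝ᵥ y = 0 by linear_combination -h3)).resolve_left hF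
    have h3 := hx v hvv hvv
    obtain ⟨r, hr⟩ : ∃ r : F, w - x = r • v := by
      refine exists_smul_eq_of_orthogonal_le fun z hz => ?_
      by_contra hne
      rw [dotProduct_comm] at hne
      obtain ⟨r, hr⟩ := exists_isotropic_add_smul hF h1 hne
      refine hne ?_
      have := hx _ hr (by rw [add_dotProduct, hz, smul_dotProduct, h3]; simp)
      rwa [dotProduct_add, dotProduct_smul, h1, smul_zero, add_zero] at this
    exact ⟨r, by rw [← hr]; abel⟩

theorem sub_dotProduct_eq_zero_iff (hF : (2 : F) ≠ 0) {v : Fin n → F} (hvv : v ⬝ᵥ v = 0)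
    (x z : Fin n → F) :
    (z - x) ⬝ᵥ v = 0 ↔ ((∃ w, (∃ r : F, w = x + r • v) ∧ (z - w) ⬝ᵥ (z - w) = 0) →
      ∀ w, (∃ r : F, w = x + r • v) → (z - w) ⬝ᵥ (z - w) = 0) := by
  have hsub : ∀ r : F, (z - (x + r • v)) ⬝ᵥ (z - (x + r • v)) =
      (z - x) ⬝ᵥ (z - x) - 2 * r * (z - x) ⬝ᵥ v := by
    intro r
    rw [← sub_sub]
    generalize z - x = d
    simp only [sub_dotProduct, dotProduct_sub, smul_dotProduct, dotProduct_smul, smul_eq_mul, hvv,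
      dotProduct_comm v d]
    ring
  constructor
  · rintro h ⟨_, ⟨r, rfl⟩, h1⟩ _ ⟨s, rfl⟩
    rw [hsub, h, mul_zero, sub_zero] at h1 ⊢
    exact h1
  · intro h
    by_contra hne
    have h1 := h ⟨_, ⟨(z - x) ⬝ᵥ (z - x) / (2 * (z - x) ⬝ᵥ v), rfl⟩, by
      rw [hsub]
      field_simp
      ring⟩
    have h2 := h1 _ ⟨0, rfl⟩
    have h3 := h1 _ ⟨1, rfl⟩
    rw [hsub] at h2 h3
    exact mul_ne_zero hF hne (by linear_combination h2 - h3)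

theorem exists_isotropic_ne_zero [Fintype F] (hF : (2 : F) ≠ 0) (hn : 3 ≤ n) :
    ∃ v : Fin n → F, v ≠ 0 ∧ v ⬝ᵥ v = 0 := by
  have hchar := two_ne_zero_iff_ringChar.1 hF
  obtain ⟨α, β, h⟩ := FiniteField.exists_root_sum_quadratic (R := F)
    (f := Polynomial.X ^ 2) (g := Polynomial.X ^ 2 + Polynomial.C 1)
    (Polynomial.degree_X_pow 2) (Polynomial.degree_X_pow_add_C two_pos 1)
    (FiniteField.odd_card_of_char_ne_two hchar)
  simp only [Polynomial.eval_add, Polynomial.eval_C, Polynomial.eval_pow, Polynomial.eval_X] at h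
  let i₀ : Fin n := ⟨0, by omega⟩
  let i₁ : Fin n := ⟨1, by omega⟩
  let i₂ : Fin n := ⟨2, by omega⟩
  have h₀₁ : i₀ ≠ i₁ := by simp [i₀, i₁]
  have h₀₂ : i₀ ≠ i₂ := by simp [i₀, i₂]
  have h₁₂ : i₁ ≠ i₂ := by simp [i₁, i₂]
  refine ⟨Pi.single i₀ α + Pi.single i₁ β + Pi.single i₂ 1, fun h0 => ?_, ?_⟩
  · simpa [Pi.single_apply, h₀₂.symm, h₁₂.symm] using congrFun h0 i₂
  · simp [h₀₁, h₀₂, h₁₂, h₀₁.symm, h₀₂.symm, h₁₂.symm]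
    linear_combination h

theorem eq_zero_of_orthogonal_isotropic [Fintype F] (hF : (2 : F) ≠ 0) (hn : 3 ≤ n)
    {d : Fin n → F} (hd : ∀ v, v ⬝ᵥ v = 0 → d ⬝ᵥ v = 0) : d = 0 := by
  obtain ⟨v, hv, hvv⟩ := exists_isotropic_ne_zero (F := F) hF hn
  have h : ∀ z, v ⬝ᵥ z ≠ 0 → d ⬝ᵥ z = 0 := by
    intro z hz
    obtain ⟨r, hr⟩ := exists_isotropic_add_smul hF hvv hz
    have := hd _ hr
    rwa [dotProduct_add, dotProduct_smul, hd v hvv, smul_zero, add_zero] at this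
  obtain ⟨u, hu⟩ := exists_dotProduct_ne_zero hv
  refine dotProduct_eq_zero _ fun z => ?_
  by_cases hz : v ⬝ᵥ z = 0
  · have := h (z + u) (by rwa [dotProduct_add, hz, zero_add])
    rwa [dotProduct_add, h u hu, add_zero] at this
  · exact h z hz

variable {γ : Equiv.Perm (Fin n → F)}
  (hγ : ∀ x y, (x - y) ⬝ᵥ (x - y) = 0 ↔ (γ x - γ y) ⬝ᵥ (γ x - γ y) = 0)

include hγ

theorem sub_dotProduct_map_eq_zero_iff (hF : (2 : F) ≠ 0) {v : Fin n → F} (hvv : v ⬝ᵥ v = 0)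
    (x z : Fin n → F) : (z - x) ⬝ᵥ v = 0 ↔ (γ z - γ x) ⬝ᵥ (γ (x + v) - γ x) = 0 := by
  have hvv' : (γ (x + v) - γ x) ⬝ᵥ (γ (x + v) - γ x) = 0 := by rw [← hγ]; simpa using hvv
  have hline : ∀ w, (∃ r : F, γ w = γ x + r • (γ (x + v) - γ x)) ↔ ∃ r : F, w = x + r • v := by
    intro w
    rw [mem_isotropic_line_iff hF hvv, mem_isotropic_line_iff hF hvv', γ.surjective.forall]
    simp only [add_sub_cancel, ← hγ]
  have h := sub_dotProduct_eq_zero_iff hF hvv' (γ x) (γ z)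
  rw [γ.surjective.exists, γ.surjective.forall] at h
  simp only [hline, ← hγ z] at h
  rw [h, sub_dotProduct_eq_zero_iff hF hvv]

theorem exists_smul_eq_map_sub (hF : (2 : F) ≠ 0) {v : Fin n → F} (hvv : v ⬝ᵥ v = 0)
    (x y : Fin n → F) : ∃ r : F, γ (x + v) - γ x = r • (γ (y + v) - γ y) := by
  refine exists_smul_eq_of_orthogonal_le fun z hz => ?_
  by_contra hne
  have hx := sub_dotProduct_map_eq_zero_iff hγ hF hvv x
  have hy := sub_dotProduct_map_eq_zero_iff hγ hF hvv y
  have key : ∀ t : F, ∃ w, γ w = γ y + t • z ∧ (w - y) ⬝ᵥ v = 0 := fun t => by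
    obtain ⟨w, hw⟩ := γ.surjective (γ y + t • z)
    exact ⟨w, hw, by rw [hy, hw, add_sub_cancel_left, smul_dotProduct, hz, smul_zero]⟩
  obtain ⟨w, hw, hwy⟩ := key ((γ x - γ y) ⬝ᵥ (γ (x + v) - γ x) / z ⬝ᵥ (γ (x + v) - γ x))
  have hwx : (w - x) ⬝ᵥ v = 0 := by
    rw [hx, hw, add_sub_right_comm, ← neg_sub, add_dotProduct, neg_dotProduct, smul_dotProduct,
      smul_eq_mul, div_mul_cancel₀ _ hne, neg_add_cancel]
  have hyx : (y - x) ⬝ᵥ v = 0 := by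
    rw [← sub_sub_sub_cancel_left x y w, sub_dotProduct, hwx, hwy, sub_zero]
  obtain ⟨w', hw', hwy'⟩ := key 1
  have h1 : (w' - x) ⬝ᵥ v = 0 := by
    rw [← sub_add_sub_cancel w' y x, add_dotProduct, hwy', hyx, add_zero]
  rw [hx] at hyx h1
  rw [hw', one_smul, add_sub_right_comm, add_dotProduct, hyx, zero_add] at h1
  exact hne h1

/-- The maps preserving isotropy of differences permute parallel classes of hyperplanes with
isotropic normal. -/
theorem exists_normal_map (hF : (2 : F) ≠ 0) {v : Fin n → F} (hvv : v ⬝ᵥ v = 0) :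
    ∃ v', ∀ x y, (x - y) ⬝ᵥ v = 0 ↔ (γ x - γ y) ⬝ᵥ v' = 0 := by
  refine ⟨γ (0 + v) - γ 0, fun x y => ?_⟩
  by_cases hv : v = 0
  · simp [hv]
  obtain ⟨r, hr⟩ := exists_smul_eq_map_sub hγ hF hvv y 0
  have hr0 : r ≠ 0 := by
    rintro rfl
    rw [zero_smul, sub_eq_zero] at hr
    exact hv (by simpa using hr)
  rw [sub_dotProduct_map_eq_zero_iff hγ hF hvv, hr, dotProduct_smul, smul_eq_mul, mul_eq_zero,
    or_iff_right hr0]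

theorem map_add_dotProduct_eq_zero (hF : (2 : F) ≠ 0) (hn : 3 ≤ n) (h0 : γ 0 = 0)
    {v v' : Fin n → F} (hv : v ≠ 0) (hvv : v ⬝ᵥ v = 0)
    (hv' : ∀ x y, (x - y) ⬝ᵥ v = 0 ↔ (γ x - γ y) ⬝ᵥ v' = 0) (x y : Fin n → F) :
    (γ (x + y) - γ x - γ y) ⬝ᵥ v' = 0 := by
  obtain ⟨w, hww, hvw⟩ : ∃ w : Fin n → F, w ⬝ᵥ w = 0 ∧ v ⬝ᵥ w = 1 := by
    obtain ⟨u, hu⟩ := exists_dotProduct_ne_zero hv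
    obtain ⟨r, hr⟩ := exists_isotropic_add_smul hF hvv hu
    refine ⟨(v ⬝ᵥ u)⁻¹ • (u + r • v), ?_, ?_⟩
    · rw [smul_dotProduct, dotProduct_smul, hr, smul_zero, smul_zero]
    · rw [dotProduct_smul, dotProduct_add, dotProduct_smul, hvv, smul_zero, add_zero, smul_eq_mul,
        inv_mul_cancel₀ hu]
  have hle := finrank_span_pair_le v w
  obtain ⟨a, ha, haa⟩ := (hasOrthogonalProjection_span_pair hvv
    (hvw.trans_ne one_ne_zero)).exists_ne_zero hF (by omega)
  have hav := ha v (Submodule.subset_span (Set.mem_insert v _))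
  have haw := ha w (Submodule.subset_span (Set.mem_insert_of_mem v rfl))
  have hva : v ⬝ᵥ a = 0 := by rw [dotProduct_comm, hav]
  have hwa : w ⬝ᵥ a = 0 := by rw [dotProduct_comm, haw]
  have hwv : w ⬝ᵥ v = 1 := by rw [dotProduct_comm, hvw]
  obtain ⟨k, hk⟩ : ∃ k : F, a ⬝ᵥ a = 2 * k := ⟨a ⬝ᵥ a / 2, by field_simp⟩
  have hk0 : k ≠ 0 := by rintro rfl; exact haa (by simpa using hk)
  set w₁ := w + a - k • v with hw₁
  set w₂ := w - a - k • v with hw₂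
  have hiso₁ : w₁ ⬝ᵥ w₁ = 0 := by
    simp only [hw₁, add_dotProduct, dotProduct_add, sub_dotProduct, dotProduct_sub,
      smul_dotProduct, dotProduct_smul, smul_eq_mul, hww, hvv, hav, haw, hva, hwa, hvw, hwv, hk]
    ring
  have hiso₂ : w₂ ⬝ᵥ w₂ = 0 := by
    simp only [hw₂, sub_dotProduct, dotProduct_sub,
      smul_dotProduct, dotProduct_smul, smul_eq_mul, hww, hvv, hav, haw, hva, hwa, hvw, hwv, hk]
    ring
  obtain ⟨w', hw'⟩ := exists_normal_map hγ hF hww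
  obtain ⟨w₁', hw₁'⟩ := exists_normal_map hγ hF hiso₁
  obtain ⟨w₂', hw₂'⟩ := exists_normal_map hγ hF hiso₂
  set X := (-(x ⬝ᵥ v) / 2) • (a - (2 : F) • w) with hX
  set Y := (-(y ⬝ᵥ v) / 2) • (-a - (2 : F) • w) with hY
  have hXw : X ⬝ᵥ w = 0 := by simp [hX, haw, hww]
  have hYw : Y ⬝ᵥ w = 0 := by simp [hY, haw, hww]
  have hXv : X ⬝ᵥ v = x ⬝ᵥ v := by
    simp only [hX, smul_dotProduct, sub_dotProduct, hav, hwv, smul_eq_mul]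
    field_simp
    ring
  have hYv : Y ⬝ᵥ v = y ⬝ᵥ v := by
    simp only [hY, smul_dotProduct, sub_dotProduct, neg_dotProduct, hav, hwv, smul_eq_mul]
    field_simp
    ring
  have hXw₂ : X ⬝ᵥ w₂ = 0 := by
    simp only [hX, hw₂, sub_dotProduct, dotProduct_sub,
      smul_dotProduct, dotProduct_smul, smul_eq_mul, hww, hav, haw, hwa, hwv, hk]
    ring
  have hYw₁ : Y ⬝ᵥ w₁ = 0 := by
    simp only [hY, hw₁, sub_dotProduct, dotProduct_sub, dotProduct_add, neg_dotProduct,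
      smul_dotProduct, dotProduct_smul, smul_eq_mul, hww, hav, haw, hwa, hwv, hk]
    ring
  have hsplit : ∀ {u u' : Fin n → F}, (∀ x y, (x - y) ⬝ᵥ u = 0 ↔ (γ x - γ y) ⬝ᵥ u' = 0) →
      Y ⬝ᵥ u = 0 → (γ (X + Y) - γ X - γ Y) ⬝ᵥ u' = 0 := by
    intro u u' hu h
    have h1 := (hu (X + Y) X).1 (by rwa [add_sub_cancel_left])
    have h2 := (hu Y 0).1 (by rwa [sub_zero])
    rw [h0, sub_zero] at h2
    rw [sub_dotProduct, h1, h2, sub_zero]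
  have hδ := hsplit hw' hYw
  have hδ₁ := hsplit hw₁' hYw₁
  have hδ₂ : (γ (X + Y) - γ X - γ Y) ⬝ᵥ w₂' = 0 := by
    have h1 := (hw₂' (X + Y) Y).1 (by rwa [add_sub_cancel_right])
    have h2 := (hw₂' X 0).1 (by rwa [sub_zero])
    rw [h0, sub_zero] at h2
    rw [sub_right_comm, sub_dotProduct, h1, h2, sub_zero]
  obtain ⟨d, hd⟩ := γ.surjective (γ (X + Y) - γ X - γ Y)
  have hback : ∀ {u u' : Fin n → F}, (∀ x y, (x - y) ⬝ᵥ u = 0 ↔ (γ x - γ y) ⬝ᵥ u' = 0) →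
      (d ⬝ᵥ u = 0 ↔ (γ (X + Y) - γ X - γ Y) ⬝ᵥ u' = 0) := by
    intro u u' hu
    simpa [h0, hd] using hu d 0
  rw [← hback hw'] at hδ
  rw [← hback hw₁'] at hδ₁
  rw [← hback hw₂'] at hδ₂
  have hdv : d ⬝ᵥ v = 0 := by
    simp only [hw₁, hw₂, dotProduct_sub, dotProduct_add, dotProduct_smul, smul_eq_mul, hδ]
      at hδ₁ hδ₂
    have : 2 * k * d ⬝ᵥ v = 0 := by linear_combination -hδ₁ - hδ₂
    simpa [hF, hk0] using this
  have h1 := (hback hv').1 hdv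
  have h2 := (hv' (x + y) (X + Y)).1 (by simp [sub_dotProduct, hXv, hYv])
  have h3 := (hv' x X).1 (by rw [sub_dotProduct, hXv, sub_self])
  have h4 := (hv' y Y).1 (by rw [sub_dotProduct, hYv, sub_self])
  simp only [sub_dotProduct] at h1 h2 h3 h4 ⊢
  linear_combination h1 + h2 - h3 - h4

/-- A permutation preserving isotropy of differences and fixing the origin is additive. -/
theorem map_add_of_isotropic [Fintype F] (hF : (2 : F) ≠ 0) (hn : 3 ≤ n) (h0 : γ 0 = 0)
    (x y : Fin n → F) : γ (x + y) = γ x + γ y := by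
  obtain ⟨d, hd⟩ := γ.surjective (γ (x + y) - γ x - γ y)
  have hd0 : d = 0 := eq_zero_of_orthogonal_isotropic hF hn fun v hvv => by
    by_cases hv : v = 0
    · rw [hv, dotProduct_zero]
    obtain ⟨v', hv'⟩ := exists_normal_map hγ hF hvv
    have := (hv' d 0).2 (by
      rw [hd, h0, sub_zero, map_add_dotProduct_eq_zero hγ hF hn h0 hv hvv hv'])
    rwa [sub_zero] at this
  rw [hd0, h0, sub_sub, eq_comm, sub_eq_zero] at hd
  exact hd

end Additivity

section IntegralAutomorphisms

variable {F : Type*} [Field F]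

/-- Integral automorphisms are additive up to a translation. -/
theorem map_add_of_isSquare [Fintype F] {n : ℕ} (hF : (2 : F) ≠ 0) (hn : 3 ≤ n)
    (γ : Equiv.Perm (Fin n → F))
    (hγ : ∀ x y, IsSquare ((x - y) ⬝ᵥ (x - y)) ↔ IsSquare ((γ x - γ y) ⬝ᵥ (γ x - γ y)))
    (x y : Fin n → F) : γ (x + y) = γ x + (γ y - γ 0) := by
  obtain ⟨m, rfl⟩ := Nat.exists_eq_add_of_le' hn
  have hiso : ∀ x y, (x - y) ⬝ᵥ (x - y) = 0 ↔ (γ x - γ y) ⬝ᵥ (γ x - γ y) = 0 := fun x y =>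
    ⟨isotropic_map hF γ hγ x y, fun h => by
      have := isotropic_map hF γ.symm
        (fun x y => by rw [hγ (γ.symm x), γ.apply_symm_apply, γ.apply_symm_apply]) _ _ h
      simpa using this⟩
  have := map_add_of_isotropic (γ := γ.trans (Equiv.subRight (γ 0)))
    (fun x y => by rw [hiso]; simp) hF hn (by simp) x y
  simp only [Equiv.trans_apply, Equiv.subRight_apply] at this
  rw [← sub_add_cancel (γ (x + y)) (γ 0), this]
  abel

theorem isSquare_sq_mul_iff {c : F} (hc : c ≠ 0) (t : F) : IsSquare (c ^ 2 * t) ↔ IsSquare t := by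
  refine ⟨fun h => ?_, fun h => (IsSquare.sq c).mul h⟩
  have := (IsSquare.sq c⁻¹).mul h
  rwa [← mul_assoc, ← mul_pow, inv_mul_cancel₀ hc, one_pow, one_mul] at this

/-- A nonzero subspace invariant under sign changes and permutations of the coordinates is the
whole space. -/
theorem Submodule.eq_top_of_signs_of_perms {ι : Type*} [Fintype ι] [DecidableEq ι]
    (hF : (2 : F) ≠ 0) (S : Submodule F (ι → F))
    (hsign : ∀ i, ∀ x ∈ S, (Function.update 1 i (-1) : ι → Fˣ) • x ∈ S)
    (hperm : ∀ σ : Equiv.Perm ι, ∀ x ∈ S, x ∘ σ ∈ S) (hS : S ≠ ⊥) : S = ⊤ := by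
  obtain ⟨b, hb, hb0⟩ := S.exists_mem_ne_zero_of_ne_bot hS
  obtain ⟨i, hi⟩ := Function.ne_iff.1 hb0
  have hsub : b - (Function.update 1 i (-1) : ι → Fˣ) • b = (2 * b i) • Pi.single i 1 := by
    funext j
    by_cases hj : j = i
    · subst hj
      simp [two_mul]
    · simp [hj]
  have h1 : Pi.single i 1 ∈ S := by
    rw [← S.smul_mem_iff (mul_ne_zero hF hi), ← hsub]
    exact S.sub_mem hb (hsign i b hb)
  have h2 : ∀ j, Pi.single j 1 ∈ S := by
    intro j
    convert hperm (Equiv.swap i j) _ h1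
    funext k
    simp [Pi.single_apply, Equiv.swap_apply_eq_iff]
  refine (Submodule.eq_top_iff').2 fun x => ?_
  rw [pi_eq_sum_univ' x]
  exact S.sum_mem fun j _ => S.smul_mem _ (by simpa [Pi.single_apply, funext_iff] using h2 j)

end IntegralAutomorphisms

/-- Let `p` be an odd prime, `q = p^h`, `n ≥ 3`. Let
`G ≤ Sym(𝔽_q^n)` be the group of integral automorphisms and `E ≤ Sym(𝔽_q^n)`
the group of translations. Then `E ≤ G`, `E` is normal in `G`, and every
nontrivial normal subgroup of `G` contains `E`; in particular `E` is the
unique minimal normal subgroup of `G`, i.e. `soc(G) = E`. -/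
theorem socle_eq_translations
    (p h n : ℕ) (hp : p.Prime) (hodd : Odd p) (hn : 3 ≤ n)
    (q : ℕ) (hq : q = p ^ h)
    (F : Type) [Field F] [Fintype F] (hF : Fintype.card F = q)
    (G E : Subgroup (Equiv.Perm (Fin n → F)))
    (hG : ∀ γ : Equiv.Perm (Fin n → F), γ ∈ G ↔
      ∀ x y : Fin n → F,
        IsSquare (∑ j, (x j - y j) ^ 2) ↔ IsSquare (∑ j, (γ x j - γ y j) ^ 2))
    (hE : ∀ γ : Equiv.Perm (Fin n → F), γ ∈ E ↔
      ∃ b : Fin n → F, ∀ x : Fin n → F, γ x = x + b) :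
    E ≤ G ∧
    (∀ g ∈ G, ∀ e ∈ E, g * e * g⁻¹ ∈ E) ∧
    (∀ N : Subgroup (Equiv.Perm (Fin n → F)), N ≤ G →
      (∀ g ∈ G, ∀ m ∈ N, g * m * g⁻¹ ∈ N) → N ≠ ⊥ → E ≤ N) := by
  have hoddcard : Odd (Fintype.card F) := by rw [hF, hq]; exact hodd.pow
  have h2 : (2 : F) ≠ 0 := two_ne_zero_iff_ringChar.2 fun hchar => by
    have := FiniteField.even_card_of_char_two hchar
    have := Nat.odd_iff.1 hoddcard
    omega
  have hadd : ∀ g ∈ G, ∀ x y, g (x + y) = g x + (g y - g 0) := fun g hg x y =>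
    map_add_of_isSquare h2 hn g
      (fun x y => by simpa only [dotProduct, Pi.sub_apply, ← sq] using (hG g).1 hg x y) x y
  have hEright : ∀ e, e ∈ E ↔ ∃ b, e = Equiv.addRight b := fun e => by
    simp [hE, Equiv.ext_iff]
  have hconj : ∀ g ∈ G, ∀ b, g * Equiv.addRight b * g⁻¹ = Equiv.addRight (g b - g 0) := by
    intro g hg b
    ext1 x
    simp [hadd g hg]
  have hEG : E ≤ G := fun e he => by
    obtain ⟨b, rfl⟩ := (hEright e).1 he
    simp [hG]
  refine ⟨hEG, fun g hg e he => ?_, fun N hNG hN hNbot e he => ?_⟩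
  · obtain ⟨b, rfl⟩ := (hEright e).1 he
    exact (hEright _).2 ⟨_, hconj g hg b⟩
  have hinv : ∀ g ∈ G, g 0 = 0 → ∀ b, Equiv.addRight b ∈ N → Equiv.addRight (g b) ∈ N := by
    intro g hg hg0 b hb
    have := hN g hg _ hb
    rwa [hconj g hg, hg0, sub_zero] at this
  have hdiag : ∀ (c : F) (ε : Fin n → Fˣ), c ≠ 0 → (∀ j, (ε j : F) ^ 2 = c ^ 2) →
      ∀ b, Equiv.addRight b ∈ N → Equiv.addRight (ε • b) ∈ N := by
    intro c ε hc hε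
    refine hinv (MulAction.toPerm ε) ((hG _).2 fun x y => ?_) (by simp)
    rw [← isSquare_sq_mul_iff hc, Finset.mul_sum]
    simp [Units.smul_def, ← mul_sub, mul_pow, hε]
  let S : Submodule F (Fin n → F) :=
    { carrier := {b | Equiv.addRight b ∈ N}
      zero_mem' := by simp
      add_mem' := fun {a b} ha hb => by simpa using N.mul_mem hb ha
      smul_mem' := fun c b hb => by
        by_cases hc : c = 0
        · simp [hc]
        · exact hdiag c (fun _ => Units.mk0 c hc) hc (fun _ => rfl) b hb }
  have hS : S = ⊤ := by
    refine Submodule.eq_top_of_signs_of_perms h2 S (fun i => hdiag 1 _ one_ne_zero fun j => ?_)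
      (fun σ => hinv (σ.symm.arrowCongr (Equiv.refl F)) ((hG _).2 fun x y => ?_) rfl) ?_
    · by_cases hj : j = i
      · subst hj
        simp
      · simp [hj]
    · rw [← Equiv.sum_comp σ]
      rfl
    · intro hSbot
      have htriv : ∀ b, Equiv.addRight b ∈ N → b = 0 := fun b hb =>
        (Submodule.eq_bot_iff S).1 hSbot b hb
      refine hNbot ((Subgroup.eq_bot_iff_forall N).2 fun g hg => ?_)
      have hcomm : ∀ b, g b = b + g 0 := by
        intro b
        have hmem := N.mul_mem hg (hN _ (hEG ((hEright _).2 ⟨b, rfl⟩)) _ (N.inv_mem hg))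
        have heq : g * (Equiv.addRight b * g⁻¹ * (Equiv.addRight b)⁻¹) =
            Equiv.addRight (g b - g 0 - b) := by
          rw [← mul_assoc, ← mul_assoc, hconj g (hNG hg)]
          ext1 x
          simp only [Equiv.Perm.mul_apply, Equiv.neg_addRight, Equiv.coe_addRight]
          abel
        rw [heq] at hmem
        rw [add_comm, ← sub_eq_zero, ← sub_sub]
        exact htriv _ hmem
      have hg' : g = Equiv.addRight (g 0) := Equiv.ext hcomm
      rw [hg', htriv (g 0) (hg' ▸ hg)]
      simp
  obtain ⟨b, rfl⟩ := (hEright e).1 he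
  exact (hS ▸ Submodule.mem_top : b ∈ S)
end

section
/- Let p be an odd prime, q = p^h, and n ≥ 3. Every integral automorphism γ of 𝔽_q^n preserves distance zero: for all x, y ∈ 𝔽_q^n, Σ_{i=1}^n (x_i − y_i)² = 0 if and only if Σ_{i=1}^n (γ(x)_i − γ(y)_i)² = 0. -/
open Finset

section GaussSums

variable {F : Type*} [Field F] [Fintype F] [DecidableEq F]

/-- The Gauss sum of the quadratic character of a finite field. -/
noncomputable def quadraticGaussSum (ψ : AddChar F ℂ) : ℂ :=
  gaussSum ((quadraticChar F).ringHomComp (Int.castRingHom ℂ)) ψ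

lemma quadraticGaussSum_sq (hF : ringChar F ≠ 2) {ψ : AddChar F ℂ} (hψ : ψ.IsPrimitive) :
    quadraticGaussSum ψ ^ 2 = (quadraticChar F (-1) * Fintype.card F : ℤ) := by
  have h := gaussSum_sq (χ := (quadraticChar F).ringHomComp (Int.castRingHom ℂ))
    ((MulChar.ringHomComp_ne_one_iff (RingHom.injective_int _)).mpr (quadraticChar_ne_one hF))
    ((quadraticChar_isQuadratic F).comp _) hψ
  simpa [quadraticGaussSum] using h

lemma sum_quadraticChar_mul_addChar (hF : ringChar F ≠ 2) (ψ : AddChar F ℂ) (b : F) :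
    ∑ y, (quadraticChar F y : ℂ) * ψ (y * b) = quadraticChar F b * quadraticGaussSum ψ := by
  rcases eq_or_ne b 0 with rfl | hb
  · have := quadraticChar_sum_zero hF
    simp only [mul_zero, AddChar.map_zero_eq_one, mul_one, MulChar.map_zero, Int.cast_zero,
      zero_mul]
    exact_mod_cast this
  · have h := gaussSum_mulShift ((quadraticChar F).ringHomComp (Int.castRingHom ℂ)) ψ
      (Units.mk0 b hb)
    have h2 : (quadraticChar F b : ℂ) ^ 2 = 1 := by exact_mod_cast quadraticChar_sq_one hb
    rw [quadraticGaussSum, ← h]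
    simp only [Units.val_mk0, MulChar.ringHomComp_apply, eq_intCast, gaussSum,
      AddChar.mulShift_apply]
    rw [← mul_assoc, ← sq, h2, one_mul]
    simp_rw [mul_comm b]

lemma sum_addChar_mul_sq (hF : ringChar F ≠ 2) {ψ : AddChar F ℂ} (hψ : ψ.IsPrimitive)
    {y : F} (hy : y ≠ 0) :
    ∑ t, ψ (y * t ^ 2) = quadraticChar F y * quadraticGaussSum ψ := by
  have h1 : ∀ u, ∑ t with t ^ 2 = u, ψ (y * t ^ 2) =
      (quadraticChar F u : ℂ) * ψ (u * y) + ψ (u * y) := by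
    intro u
    have hc := quadraticChar_card_sqrts hF u
    rw [Finset.sum_congr rfl (g := fun _ => ψ (u * y))
      (fun t ht => by rw [(Finset.mem_filter.mp ht).2, mul_comm]), Finset.sum_const, nsmul_eq_mul]
    have hc' : ((#{t : F | t ^ 2 = u} : ℕ) : ℂ) = quadraticChar F u + 1 := by
      rw [← Int.cast_natCast]
      rw [Set.toFinset_ofPred] at hc
      rw [hc]; push_cast; rfl
    rw [hc']; ring
  rw [← Finset.sum_fiberwise _ (fun t => t ^ 2), Finset.sum_congr rfl (fun u _ => h1 u),
    Finset.sum_add_distrib, sum_quadraticChar_mul_addChar hF, AddChar.sum_mulShift y hψ]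
  simp [hy]

lemma sum_addChar_quadratic (hF : ringChar F ≠ 2) {ψ : AddChar F ℂ} (hψ : ψ.IsPrimitive)
    {y : F} (hy : y ≠ 0) (c : F) :
    ∑ t, ψ (y * t ^ 2 + 2 * (t * c)) =
      quadraticChar F y * quadraticGaussSum ψ * ψ (-(c ^ 2 / y)) := by
  rw [← sum_addChar_mul_sq hF hψ hy, Finset.sum_mul,
    ← Equiv.sum_comp (Equiv.addRight (c / y)) fun t => ψ (y * t ^ 2) * ψ (-(c ^ 2 / y))]
  refine Finset.sum_congr rfl fun t _ => ?_
  rw [← AddChar.map_add_eq_mul]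
  congr 1
  simp only [Equiv.coe_addRight]
  field_simp
  ring

omit [Fintype F] [DecidableEq F] in
lemma addChar_map_sum {ι : Type*} (ψ : AddChar F ℂ) (s : Finset ι) (f : ι → F) :
    ψ (∑ i ∈ s, f i) = ∏ i ∈ s, ψ (f i) := by
  classical
  induction s using Finset.induction_on with
  | empty => simp
  | insert i s hi ih => rw [sum_insert hi, prod_insert hi, AddChar.map_add_eq_mul, ih]

lemma sum_addChar_dotProduct (hF : ringChar F ≠ 2) {ψ : AddChar F ℂ} (hψ : ψ.IsPrimitive)
    {n : ℕ} {y : F} (hy : y ≠ 0) (c : Fin n → F) :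
    ∑ z, ψ (y * (z ⬝ᵥ z) + 2 * (z ⬝ᵥ c)) =
      (quadraticChar F y * quadraticGaussSum ψ) ^ n * ψ (-((c ⬝ᵥ c) / y)) := by
  have h : ∀ z : Fin n → F, ψ (y * (z ⬝ᵥ z) + 2 * (z ⬝ᵥ c)) =
      ∏ i, ψ (y * z i ^ 2 + 2 * (z i * c i)) := by
    intro z
    rw [← addChar_map_sum]
    simp only [dotProduct, Finset.mul_sum, ← Finset.sum_add_distrib, sq]
  rw [Finset.sum_congr rfl fun z _ => h z, ← Fintype.piFinset_univ,
    ← Finset.prod_univ_sum (fun _ => Finset.univ) (fun i t => ψ (y * t ^ 2 + 2 * (t * c i)))]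
  simp_rw [sum_addChar_quadratic hF hψ hy]
  rw [Finset.prod_mul_distrib, Finset.prod_const, Finset.card_univ, Fintype.card_fin,
    ← addChar_map_sum]
  simp [dotProduct, Finset.sum_div, sq]

omit [Fintype F] [DecidableEq F] in
lemma sum_addChar_linear {E : Type*} [AddCommGroup E] [Module F E] [Fintype E]
    {ψ : AddChar F ℂ} (hψ : ψ.IsPrimitive) (l : E →ₗ[F] F) [Decidable (l = 0)] :
    ∑ s, ψ (l s) = if l = 0 then (Fintype.card E : ℂ) else 0 := by
  classical
  have h := AddChar.sum_eq_ite (ψ.compAddMonoidHom l.toAddMonoidHom)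
  have h0 : ψ.compAddMonoidHom l.toAddMonoidHom = 0 ↔ l = 0 := by
    constructor
    · intro h
      by_contra hl
      obtain ⟨s, hs⟩ : ∃ s, l s ≠ 0 := by
        by_contra! hs
        exact hl (LinearMap.ext hs)
      apply hψ hs
      ext x
      have := DFunLike.congr_fun h (x • s)
      simpa [AddChar.mulShift_apply, mul_comm] using this
    · rintro rfl
      ext x
      simp
  simpa [h0] using h

/-- The number of solutions of a system of one diagonal quadratic and several linear equations,
as an exponential sum. -/
lemma card_mul_card_filter_quadratic_linear {E : Type*} [AddCommGroup E] [Module F E] [Fintype E]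
    (hF : ringChar F ≠ 2) {ψ : AddChar F ℂ} (hψ : ψ.IsPrimitive)
    {n : ℕ} (L : E →ₗ[F] Fin n → F) (hL : Function.Injective L) (a : F) (b : E →ₗ[F] F) :
    (Fintype.card F * Fintype.card E : ℂ) *
      Nat.card {z : Fin n → F // z ⬝ᵥ z = a ∧ ∀ s, 2 * (z ⬝ᵥ L s) = b s} =
    (Fintype.card F : ℂ) ^ n + ∑ y ∈ univ.erase (0 : F), ∑ s,
      (quadraticChar F y * quadraticGaussSum ψ) ^ n *
        ψ (-(y * ((L s ⬝ᵥ L s) + b s + a))) := by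
  classical
  have h2 : (2 : F) ≠ 0 := Ring.two_ne_zero hF
  have hdot : ∀ z c d : Fin n → F, ∀ r : F, z ⬝ᵥ (r • c + d) = r * (z ⬝ᵥ c) + z ⬝ᵥ d := by
    intro z c d r; simp [dotProduct_add]
  let l : (Fin n → F) → E →ₗ[F] F := fun z =>
    { toFun := fun s => 2 * (z ⬝ᵥ L s) - b s
      map_add' := fun s t => by simp [dotProduct_add]; ring
      map_smul' := fun r s => by simp; ring }
  have hl : ∀ z, l z = 0 ↔ ∀ s, 2 * (z ⬝ᵥ L s) = b s := by
    intro z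
    simp [LinearMap.ext_iff, l, sub_eq_zero]
  have hone : ∀ z : Fin n → F, (∑ y, ψ (y * (z ⬝ᵥ z - a))) * (∑ s, ψ (l z s)) =
      if z ⬝ᵥ z = a ∧ ∀ s, 2 * (z ⬝ᵥ L s) = b s then
        (Fintype.card F * Fintype.card E : ℂ) else 0 := by
    intro z
    rw [AddChar.sum_mulShift _ hψ, sum_addChar_linear hψ]
    simp only [hl, sub_eq_zero]
    by_cases h : z ⬝ᵥ z = a <;> by_cases h' : ∀ s, 2 * (z ⬝ᵥ L s) = b s <;> simp [h, h']
  have hcount : (Fintype.card F * Fintype.card E : ℂ) *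
      Nat.card {z : Fin n → F // z ⬝ᵥ z = a ∧ ∀ s, 2 * (z ⬝ᵥ L s) = b s} =
      ∑ z : Fin n → F, (∑ y, ψ (y * (z ⬝ᵥ z - a))) * (∑ s, ψ (l z s)) := by
    rw [Finset.sum_congr rfl fun z _ => hone z, ← Finset.sum_filter, Finset.sum_const,
      nsmul_eq_mul, Nat.card_eq_fintype_card, Fintype.card_subtype, mul_comm]
  have hswap : ∑ z : Fin n → F, (∑ y, ψ (y * (z ⬝ᵥ z - a))) * (∑ s, ψ (l z s)) =
      ∑ y, ∑ s, ∑ z : Fin n → F, ψ (y * (z ⬝ᵥ z) + 2 * (z ⬝ᵥ L s)) * ψ (-(y * a + b s)) := by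
    simp_rw [Finset.sum_mul_sum]
    rw [Finset.sum_comm]
    refine Finset.sum_congr rfl fun y _ => ?_
    rw [Finset.sum_comm]
    refine Finset.sum_congr rfl fun s _ => Finset.sum_congr rfl fun z _ => ?_
    rw [← AddChar.map_add_eq_mul, ← AddChar.map_add_eq_mul]
    congr 1
    simp only [l, LinearMap.coe_mk, AddHom.coe_mk]
    ring
  rw [hcount, hswap, ← Finset.add_sum_erase _ _ (Finset.mem_univ (0 : F))]
  congr 1
  · rw [Finset.sum_eq_single 0]
    · simp
    · intro s _ hs
      rw [← Finset.sum_mul]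
      let k : (Fin n → F) →ₗ[F] F :=
        { toFun := fun z => 2 * (z ⬝ᵥ L s)
          map_add' := fun z w => by simp [add_dotProduct]; ring
          map_smul' := fun r z => by simp; ring }
      have hk : k ≠ 0 := by
        intro hk
        apply hs
        apply hL
        rw [map_zero]
        ext i
        have := LinearMap.congr_fun hk (Pi.single i 1)
        simpa [k, h2] using this
      have := sum_addChar_linear hψ k
      rw [if_neg hk] at this
      simp only [zero_mul, zero_add]
      rw [show ∑ z : Fin n → F, ψ (2 * (z ⬝ᵥ L s)) = 0 from this, zero_mul]
    · simp
  · refine Finset.sum_congr rfl fun y hy => ?_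
    have hy : y ≠ 0 := Finset.ne_of_mem_erase hy
    rw [← (LinearEquiv.smulOfNeZero F E y hy).toEquiv.sum_comp]
    refine Finset.sum_congr rfl fun s _ => ?_
    rw [← Finset.sum_mul, sum_addChar_dotProduct hF hψ hy, mul_assoc, ← AddChar.map_add_eq_mul]
    congr 2
    simp
    field_simp
    ring

end GaussSums

section Counting

variable {F : Type*} [Field F] [Fintype F] [DecidableEq F]

omit [DecidableEq F] in
lemma exists_isPrimitive_addChar_complex : ∃ ψ : AddChar F ℂ, ψ.IsPrimitive :=
  ⟨_, AddChar.FiniteField.primitiveChar_to_Complex_isPrimitive F⟩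

lemma quadraticChar_neg_one_pow_add_two (j : ℕ) :
    quadraticChar F (-1) ^ (j + 2) = quadraticChar F (-1) ^ j := by
  rw [pow_add, quadraticChar_sq_one (neg_ne_zero.mpr one_ne_zero), mul_one]

lemma card_filter_quadratic_one_linear (hF : ringChar F ≠ 2) (j : ℕ) {v : Fin (2 * j + 3) → F}
    (hv : v ≠ 0) (a b : F) :
    (Nat.card {z : Fin (2 * j + 3) → F // z ⬝ᵥ z = a ∧ 2 * (z ⬝ᵥ v) = b} : ℤ) =
      (Fintype.card F : ℤ) ^ (2 * j + 1) + quadraticChar F (-1) ^ j * (Fintype.card F : ℤ) ^ j *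
        ∑ s, quadraticChar F (-(v ⬝ᵥ v) * s ^ 2 + -b * s + -a) := by
  obtain ⟨ψ, hψ⟩ := exists_isPrimitive_addChar_complex (F := F)
  have h := card_mul_card_filter_quadratic_linear hF hψ (LinearMap.toSpanSingleton F _ v)
    (LinearMap.ker_eq_bot.mp (LinearMap.ker_toSpanSingleton F hv)) a (LinearMap.mulLeft F b)
  have hset : ∀ z : Fin (2 * j + 3) → F, (∀ s, 2 * (z ⬝ᵥ LinearMap.toSpanSingleton F _ v s) =
      LinearMap.mulLeft F b s) ↔ 2 * (z ⬝ᵥ v) = b := by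
    intro z
    constructor
    · intro h
      simpa using h 1
    · rintro rfl s
      simp only [LinearMap.toSpanSingleton_apply, dotProduct_smul, smul_eq_mul,
        LinearMap.mulLeft_apply]
      ring
  simp only [hset] at h
  rw [Finset.sum_comm] at h
  have hsum : ∀ s : F, ∑ y ∈ univ.erase (0 : F),
      (quadraticChar F y * quadraticGaussSum ψ) ^ (2 * j + 3) *
        ψ (-(y * ((LinearMap.toSpanSingleton F _ v s ⬝ᵥ LinearMap.toSpanSingleton F _ v s) +
          LinearMap.mulLeft F b s + a))) =
      (quadraticGaussSum ψ ^ 2) ^ (j + 2) *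
        quadraticChar F (-(v ⬝ᵥ v) * s ^ 2 + -b * s + -a) := by
    intro s
    have := sum_quadraticChar_mul_addChar hF ψ (-(v ⬝ᵥ v) * s ^ 2 + -b * s + -a)
    rw [← Finset.add_sum_erase _ _ (Finset.mem_univ (0 : F)), MulChar.map_zero, Int.cast_zero,
      zero_mul, zero_add] at this
    rw [show (quadraticGaussSum ψ ^ 2) ^ (j + 2) *
        (quadraticChar F (-(v ⬝ᵥ v) * s ^ 2 + -b * s + -a) : ℂ) =
        quadraticGaussSum ψ ^ (2 * j + 3) *
        (quadraticChar F (-(v ⬝ᵥ v) * s ^ 2 + -b * s + -a) * quadraticGaussSum ψ) by ring,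
      ← this, Finset.mul_sum]
    refine Finset.sum_congr rfl fun y hy => ?_
    have h2 : (quadraticChar F y : ℂ) ^ 2 = 1 := by
      exact_mod_cast quadraticChar_sq_one (Finset.ne_of_mem_erase hy)
    rw [mul_pow, show (quadraticChar F y : ℂ) ^ (2 * j + 3) = quadraticChar F y by
      rw [show 2 * j + 3 = 2 * (j + 1) + 1 by ring, pow_succ, pow_mul, h2, one_pow, one_mul],
      mul_comm (quadraticChar F y : ℂ), mul_assoc]
    congr 3
    simp
    ring
  rw [Finset.sum_congr rfl fun s _ => hsum s, ← Finset.mul_sum, quadraticGaussSum_sq hF hψ] at h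
  have h' : (Fintype.card F * Fintype.card F : ℤ) *
      Nat.card {z : Fin (2 * j + 3) → F // z ⬝ᵥ z = a ∧ 2 * (z ⬝ᵥ v) = b} =
      (Fintype.card F : ℤ) ^ (2 * j + 3) + (quadraticChar F (-1) * Fintype.card F) ^ (j + 2) *
        ∑ s, quadraticChar F (-(v ⬝ᵥ v) * s ^ 2 + -b * s + -a) := by
    exact_mod_cast h
  have hq : (Fintype.card F * Fintype.card F : ℤ) ≠ 0 := by
    simp [Fintype.card_ne_zero]
  apply mul_left_cancel₀ hq
  rw [h', mul_pow, quadraticChar_neg_one_pow_add_two]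
  ring

lemma card_filter_quadratic_two_linear (hF : ringChar F ≠ 2) (j : ℕ)
    {v w : Fin (2 * j + 4) → F} (hvw : ∀ s t : F, s • v + t • w = 0 → s = 0 ∧ t = 0)
    (hw : w ⬝ᵥ w ≠ 0) (a b c : F) :
    (Nat.card {z : Fin (2 * j + 4) → F //
        z ⬝ᵥ z = a ∧ 2 * (z ⬝ᵥ v) = b ∧ 2 * (z ⬝ᵥ w) = c} : ℤ) =
      (Fintype.card F : ℤ) ^ (2 * j + 1) + quadraticChar F (-1) ^ j * (Fintype.card F : ℤ) ^ j *
        ∑ s, quadraticChar F (4 * ((v ⬝ᵥ w) ^ 2 - (v ⬝ᵥ v) * (w ⬝ᵥ w)) * s ^ 2 +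
          4 * ((v ⬝ᵥ w) * c - (w ⬝ᵥ w) * b) * s + (c ^ 2 - 4 * (w ⬝ᵥ w) * a)) := by
  obtain ⟨ψ, hψ⟩ := exists_isPrimitive_addChar_complex (F := F)
  have h2 : (2 : F) ≠ 0 := Ring.two_ne_zero hF
  have h4 : (4 : F) ≠ 0 := by
    rw [show (4 : F) = 2 * 2 by norm_num]; exact mul_ne_zero h2 h2
  let L : F × F →ₗ[F] Fin (2 * j + 4) → F :=
    (LinearMap.toSpanSingleton F _ v).coprod (LinearMap.toSpanSingleton F _ w)
  let l : F × F →ₗ[F] F := (LinearMap.mulLeft F b).coprod (LinearMap.mulLeft F c)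
  have hL : Function.Injective L := by
    rw [injective_iff_map_eq_zero]
    rintro ⟨s, t⟩ hst
    obtain ⟨rfl, rfl⟩ := hvw s t (by simpa [L] using hst)
    rfl
  have h := card_mul_card_filter_quadratic_linear hF hψ L hL a l
  have hset : ∀ z : Fin (2 * j + 4) → F, (∀ s, 2 * (z ⬝ᵥ L s) = l s) ↔
      2 * (z ⬝ᵥ v) = b ∧ 2 * (z ⬝ᵥ w) = c := by
    intro z
    constructor
    · intro h
      exact ⟨by simpa [L, l] using h (1, 0), by simpa [L, l] using h (0, 1)⟩
    · rintro ⟨rfl, rfl⟩ ⟨s, t⟩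
      simp [L, l, dotProduct_add]
      ring
  simp only [hset] at h
  set D : F → F := fun s => 4 * ((v ⬝ᵥ w) ^ 2 - (v ⬝ᵥ v) * (w ⬝ᵥ w)) * s ^ 2 +
          4 * ((v ⬝ᵥ w) * c - (w ⬝ᵥ w) * b) * s + (c ^ 2 - 4 * (w ⬝ᵥ w) * a) with hD
  have hinner : ∀ y ∈ univ.erase (0 : F), ∀ s : F,
      ∑ t, ψ (-(y * ((L (s, t) ⬝ᵥ L (s, t)) + l (s, t) + a))) =
      quadraticChar F (-(y * (w ⬝ᵥ w))) * quadraticGaussSum ψ *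
        ψ (y * (D s / (4 * (w ⬝ᵥ w)))) := by
    intro y hy s
    have hy : y ≠ 0 := Finset.ne_of_mem_erase hy
    have hyw : -(y * (w ⬝ᵥ w)) ≠ 0 := neg_ne_zero.mpr (mul_ne_zero hy hw)
    have hq := sum_addChar_quadratic hF hψ hyw (-(y * (s * (v ⬝ᵥ w) + c / 2)))
    have hsplit : ∀ t, ψ (-(y * ((L (s, t) ⬝ᵥ L (s, t)) + l (s, t) + a))) =
        ψ (-(y * (w ⬝ᵥ w)) * t ^ 2 + 2 * (t * -(y * (s * (v ⬝ᵥ w) + c / 2)))) *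
          ψ (-(y * ((v ⬝ᵥ v) * s ^ 2 + b * s + a))) := by
      intro t
      rw [← AddChar.map_add_eq_mul]
      congr 1
      simp only [L, l, LinearMap.coprod_apply, LinearMap.toSpanSingleton_apply, dotProduct_add,
        add_dotProduct, smul_dotProduct, dotProduct_smul, smul_eq_mul, LinearMap.mulLeft_apply,
        dotProduct_comm w v]
      field_simp
      ring
    rw [Finset.sum_congr rfl fun t _ => hsplit t, ← Finset.sum_mul, hq, mul_assoc,
      ← AddChar.map_add_eq_mul]
    congr 2
    simp only [hD]
    field_simp
    ring
  have hs : ∀ s : F, ∑ y ∈ univ.erase (0 : F), quadraticGaussSum ψ ^ (2 * j + 4) *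
      (quadraticChar F (-(y * (w ⬝ᵥ w))) * quadraticGaussSum ψ *
        ψ (y * (D s / (4 * (w ⬝ᵥ w))))) =
      (quadraticGaussSum ψ ^ 2) ^ (j + 3) * (quadraticChar F (-1) * quadraticChar F (D s)) := by
    intro s
    have := sum_quadraticChar_mul_addChar hF ψ (D s / (4 * (w ⬝ᵥ w)))
    rw [← Finset.add_sum_erase _ _ (Finset.mem_univ (0 : F)), MulChar.map_zero, Int.cast_zero,
      zero_mul, zero_add] at this
    have hχ : (quadraticChar F (-1) : ℂ) * quadraticChar F (D s) =
        quadraticChar F (-(w ⬝ᵥ w)) * quadraticChar F (D s / (4 * (w ⬝ᵥ w))) := by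
      rw [← Int.cast_mul, ← Int.cast_mul, ← map_mul, ← map_mul,
        show -(w ⬝ᵥ w) * (D s / (4 * (w ⬝ᵥ w))) = -1 * D s * (2⁻¹) ^ 2 by field_simp; norm_num,
        map_mul _ _ ((2⁻¹ : F) ^ 2), quadraticChar_sq_one' (inv_ne_zero h2), mul_one]
    rw [hχ, show (quadraticGaussSum ψ ^ 2) ^ (j + 3) * ((quadraticChar F (-(w ⬝ᵥ w)) : ℂ) *
          quadraticChar F (D s / (4 * (w ⬝ᵥ w)))) =
        quadraticGaussSum ψ ^ (2 * j + 5) * quadraticChar F (-(w ⬝ᵥ w)) *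
          (quadraticChar F (D s / (4 * (w ⬝ᵥ w))) * quadraticGaussSum ψ) by ring,
      ← this, Finset.mul_sum]
    refine Finset.sum_congr rfl fun y hy => ?_
    rw [show -(y * (w ⬝ᵥ w)) = -(w ⬝ᵥ w) * y by ring, map_mul]
    push_cast
    ring
  have hsum : ∑ y ∈ univ.erase (0 : F), ∑ s,
      (quadraticChar F y * quadraticGaussSum ψ) ^ (2 * j + 4) *
        ψ (-(y * ((L s ⬝ᵥ L s) + l s + a))) =
      (quadraticGaussSum ψ ^ 2) ^ (j + 3) *
        (quadraticChar F (-1) * ∑ s, (quadraticChar F (D s) : ℂ)) := by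
    rw [Finset.mul_sum, Finset.mul_sum, ← Finset.sum_congr rfl fun s _ => hs s,
      Finset.sum_comm (s := univ)]
    refine Finset.sum_congr rfl fun y hy => ?_
    have hy2 : (quadraticChar F y : ℂ) ^ (2 * j + 4) = 1 := by
      have : (quadraticChar F y : ℂ) ^ 2 = 1 := by
        exact_mod_cast quadraticChar_sq_one (Finset.ne_of_mem_erase hy)
      rw [show 2 * j + 4 = 2 * (j + 2) by ring, pow_mul, this, one_pow]
    rw [← Finset.mul_sum, Fintype.sum_prod_type, mul_pow, hy2, one_mul, ← Finset.mul_sum,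
      Finset.sum_congr rfl fun s _ => hinner y hy s]
  rw [hsum, quadraticGaussSum_sq hF hψ] at h
  have h' : (Fintype.card F * Fintype.card (F × F) : ℤ) *
      Nat.card {z : Fin (2 * j + 4) → F //
        z ⬝ᵥ z = a ∧ 2 * (z ⬝ᵥ v) = b ∧ 2 * (z ⬝ᵥ w) = c} =
      (Fintype.card F : ℤ) ^ (2 * j + 4) + (quadraticChar F (-1) * Fintype.card F) ^ (j + 3) *
        (quadraticChar F (-1) * ∑ s, quadraticChar F (D s)) := by
    exact_mod_cast h
  have hq : (Fintype.card F * Fintype.card (F × F) : ℤ) ≠ 0 := by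
    simp [Fintype.card_ne_zero]
  apply mul_left_cancel₀ hq
  rw [h', mul_pow, pow_succ' (quadraticChar F (-1)), quadraticChar_neg_one_pow_add_two,
    Fintype.card_prod]
  have := quadraticChar_sq_one (F := F) (a := -1) (neg_ne_zero.mpr one_ne_zero)
  push_cast
  linear_combination (quadraticChar F (-1) ^ j * (Fintype.card F : ℤ) ^ (j + 3) *
    ∑ s, quadraticChar F (D s)) * this

lemma exists_orthogonal_of_isotropic (hF : ringChar F ≠ 2) (j : ℕ)
    {u : Fin (2 * j + 4) → F} (hu : u ≠ 0) (huu : u ⬝ᵥ u = 0) {a : F} (ha : a ≠ 0) :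
    ∃ z, z ⬝ᵥ z = a ∧ u ⬝ᵥ z = 0 := by
  obtain ⟨ψ, hψ⟩ := exists_isPrimitive_addChar_complex (F := F)
  have h2 : (2 : F) ≠ 0 := Ring.two_ne_zero hF
  have h := card_mul_card_filter_quadratic_linear hF hψ (LinearMap.toSpanSingleton F _ u)
    (LinearMap.ker_eq_bot.mp (LinearMap.ker_toSpanSingleton F hu)) a 0
  by_contra! hcon
  have hempty : IsEmpty {z : Fin (2 * j + 4) → F // z ⬝ᵥ z = a ∧
      ∀ s, 2 * (z ⬝ᵥ LinearMap.toSpanSingleton F _ u s) = (0 : F →ₗ[F] F) s} := by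
    refine ⟨fun ⟨z, hz, hz'⟩ => hcon z hz ?_⟩
    simpa [h2, dotProduct_comm u] using hz' 1
  have hsum : ∑ y ∈ univ.erase (0 : F), ∑ s,
      (quadraticChar F y * quadraticGaussSum ψ) ^ (2 * j + 4) *
        ψ (-(y * ((LinearMap.toSpanSingleton F _ u s ⬝ᵥ LinearMap.toSpanSingleton F _ u s) +
          (0 : F →ₗ[F] F) s + a))) = -((quadraticGaussSum ψ ^ 2) ^ (j + 2) * Fintype.card F) := by
    have := AddChar.sum_mulShift (-a) hψ
    rw [← Finset.add_sum_erase _ _ (Finset.mem_univ (0 : F)), if_neg (neg_ne_zero.mpr ha),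
      zero_mul, AddChar.map_zero_eq_one, add_comm, Nat.cast_zero,
      add_eq_zero_iff_eq_neg] at this
    rw [← neg_one_mul, ← this, Finset.sum_mul]
    refine Finset.sum_congr rfl fun y hy => ?_
    have hy2 : (quadraticChar F y : ℂ) ^ (2 * j + 4) = 1 := by
      have : (quadraticChar F y : ℂ) ^ 2 = 1 := by
        exact_mod_cast quadraticChar_sq_one (Finset.ne_of_mem_erase hy)
      rw [show 2 * j + 4 = 2 * (j + 2) by ring, pow_mul, this, one_pow]
    simp only [LinearMap.toSpanSingleton_apply, dotProduct_smul, smul_dotProduct, huu,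
      smul_zero, LinearMap.zero_apply, zero_add, mul_pow, hy2, one_mul, Finset.sum_const,
      Finset.card_univ, nsmul_eq_mul, mul_neg]
    ring
  rw [hsum, Nat.card_of_isEmpty, quadraticGaussSum_sq hF hψ] at h
  have h' : (Fintype.card F : ℤ) ^ (2 * j + 4) =
      (quadraticChar F (-1) * Fintype.card F) ^ (j + 2) * Fintype.card F := by
    have : (Fintype.card F : ℂ) ^ (2 * j + 4) =
      (quadraticChar F (-1) * Fintype.card F : ℤ) ^ (j + 2) * Fintype.card F := by
      linear_combination -h
    exact_mod_cast this
  have h1 : 1 < (Fintype.card F : ℤ) := by exact_mod_cast Fintype.one_lt_card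
  have hdvd : (Fintype.card F : ℤ) ^ (j + 1) = quadraticChar F (-1) ^ j := by
    have hq : (Fintype.card F : ℤ) ^ (j + 3) ≠ 0 := by positivity
    apply mul_left_cancel₀ hq
    rw [mul_pow, quadraticChar_neg_one_pow_add_two] at h'
    linear_combination h'
  have hle : quadraticChar F (-1) ^ j ≤ 1 := by
    rcases quadraticChar_dichotomy (F := F) (a := -1) (neg_ne_zero.mpr one_ne_zero) with h | h
    · simp [h]
    · rw [h]
      rcases neg_one_pow_eq_or ℤ j with h | h <;> simp [h]
  have := one_lt_pow₀ h1 (Nat.succ_ne_zero j)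
  rw [Nat.succ_eq_add_one, hdvd] at this
  exact absurd hle this.not_ge

/-- Modulo the characteristic, a quadratic character sum over the values of a polynomial of degree
at most two depends only on the coefficient of degree two. -/
lemma cast_sum_quadraticChar_quadratic (hF : ringChar F ≠ 2) (α β γ : F) :
    ((∑ s, quadraticChar F (α * s ^ 2 + β * s + γ) : ℤ) : F) = -(quadraticChar F α : F) := by
  open Polynomial in
  have hodd : Fintype.card F = 2 * (Fintype.card F / 2) + 1 := by
    have := FiniteField.odd_card_of_char_ne_two hF
    omega
  set P : F[X] := (C α * X ^ 2 + C β * X + C γ) ^ (Fintype.card F / 2) with hP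
  have hdeg2 : (C α * X ^ 2 + C β * X + C γ : F[X]).natDegree ≤ 2 := natDegree_quadratic_le
  have hdeg : P.natDegree < Fintype.card F := by
    have : P.natDegree ≤ _ := natDegree_pow_le_of_le (Fintype.card F / 2) hdeg2
    omega
  have hlead : P.coeff (Fintype.card F - 1) = α ^ (Fintype.card F / 2) := by
    have := coeff_pow_of_natDegree_le (m := Fintype.card F / 2) hdeg2
    rw [hP, show Fintype.card F - 1 = Fintype.card F / 2 * 2 by omega, this]
    simp
  push_cast
  simp_rw [quadraticChar_eq_pow_of_char_ne_two' hF]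
  have heval : ∀ s : F, (α * s ^ 2 + β * s + γ) ^ (Fintype.card F / 2) = P.eval s := by
    intro s; simp [hP]
  simp_rw [heval, eval_eq_sum_range' hdeg]
  have hsum : ∑ s : F, s ^ (Fintype.card F - 1) = -1 := by
    have h1 : ∀ s : F, s ^ (Fintype.card F - 1) = 1 - if s = 0 then 1 else 0 := by
      intro s
      rcases eq_or_ne s 0 with rfl | hs
      · have : Fintype.card F - 1 ≠ 0 := by have := Fintype.one_lt_card (α := F); omega
        simp [this]
      · simp [hs, FiniteField.pow_card_sub_one_eq_one s hs]
    simp_rw [h1]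
    simp
  rw [Finset.sum_comm]
  simp_rw [← Finset.mul_sum]
  rw [Finset.sum_eq_single (Fintype.card F - 1), hlead, hsum]
  · ring
  · intro i hi hne
    rw [FiniteField.sum_pow_lt_card_sub_one F i (by have := Finset.mem_range.mp hi; omega),
      mul_zero]
  · intro h
    exact absurd (Finset.mem_range.mpr (by omega)) h

end Counting

section CommonNeighbours

variable {F : Type*} [Field F] [Fintype F] [DecidableEq F]

lemma two_mul_card_isSquare (hF : ringChar F ≠ 2) [DecidablePred (IsSquare : F → Prop)] :
    2 * (#{a : F | IsSquare a} : ℤ) = Fintype.card F + 1 := by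
  have h1 : ∀ a : F, 2 * (if IsSquare a then (1 : ℤ) else 0) =
      1 + quadraticChar F a + if a = 0 then 1 else 0 := by
    intro a
    rcases eq_or_ne a 0 with rfl | ha
    · simp
    · by_cases hs : IsSquare a
      · rw [(quadraticChar_one_iff_isSquare ha).mpr hs]; simp [hs, ha]
      · rw [quadraticChar_neg_one_iff_not_isSquare.mpr hs]; simp [hs, ha]
  rw [Finset.card_filter]
  push_cast
  rw [Finset.mul_sum, Finset.sum_congr rfl fun a _ => h1 a, Finset.sum_add_distrib,
    Finset.sum_add_distrib, quadraticChar_sum_zero hF]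
  simp

lemma cast_card_isSquare_ne_zero (hF : ringChar F ≠ 2)
    [DecidablePred (IsSquare : F → Prop)] : (#{a : F | IsSquare a} : F) ≠ 0 := by
  intro h
  have := congrArg (Int.cast : ℤ → F) (two_mul_card_isSquare hF)
  push_cast at this
  rw [h] at this
  simp at this

/-- Divisibility of a sum of counts of the shape produced by
`card_filter_quadratic_one_linear` and `card_filter_quadratic_two_linear`. -/
lemma ringChar_mul_pow_dvd_sum_iff {ι : Type*} (I : Finset ι) (hI : (#I : F) ≠ 0) (j : ℕ)
    (N : ι → ℕ) (T : ι → ℤ) (α : F)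
    (hN : ∀ i ∈ I, (N i : ℤ) = (Fintype.card F : ℤ) ^ (2 * j + 1) +
      quadraticChar F (-1) ^ j * (Fintype.card F : ℤ) ^ j * T i)
    (hT : ∀ i ∈ I, (T i : F) = -(quadraticChar F α : F)) :
    ringChar F * Fintype.card F ^ j ∣ ∑ i ∈ I, N i ↔ α = 0 := by
  have hsum : ((∑ i ∈ I, N i : ℕ) : ℤ) = (#I * (Fintype.card F : ℤ) ^ (j + 1) +
      quadraticChar F (-1) ^ j * ∑ i ∈ I, T i) * (Fintype.card F : ℤ) ^ j := by
    push_cast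
    rw [Finset.sum_congr rfl hN, Finset.sum_add_distrib, ← Finset.mul_sum, Finset.sum_const,
      nsmul_eq_mul]
    ring
  have hq : (Fintype.card F : ℤ) ^ j ≠ 0 := pow_ne_zero _ (by simp [Fintype.card_ne_zero])
  rw [← Int.natCast_dvd_natCast, hsum, Nat.cast_mul, Nat.cast_pow, mul_dvd_mul_iff_right hq,
    ← CharP.intCast_eq_zero_iff F]
  push_cast
  rw [Finset.sum_congr rfl hT]
  have hε : (quadraticChar F (-1) : F) ≠ 0 := by
    rcases quadraticChar_dichotomy (F := F) (a := -1) (neg_ne_zero.mpr one_ne_zero) with h | h <;>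
      simp only [h] <;> simp
  have hα : (quadraticChar F α : F) = 0 ↔ α = 0 := by
    constructor
    · intro h
      by_contra hα
      rcases quadraticChar_dichotomy hα with h' | h' <;> rw [h'] at h <;> simp at h
    · rintro rfl
      simp only [MulChar.map_zero, Int.cast_zero]
  simp only [FiniteField.cast_card_eq_zero, ne_eq, Nat.add_eq_zero_iff, one_ne_zero, and_false,
    not_false_eq_true, zero_pow, mul_zero, zero_add, Finset.sum_const, nsmul_eq_mul,
    mul_eq_zero, pow_eq_zero_iff', hε, false_and, hI, neg_eq_zero, hα, false_or]

omit [Fintype F] [DecidableEq F] in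
lemma dotProduct_sub_self {n : ℕ} (z v : Fin n → F) :
    (z - v) ⬝ᵥ (z - v) = z ⬝ᵥ z - 2 * (z ⬝ᵥ v) + v ⬝ᵥ v := by
  rw [sub_dotProduct, dotProduct_sub, dotProduct_sub, dotProduct_comm v z]
  ring

/-- In odd dimension, the number of common neighbours of two points detects whether their distance
is zero. -/
lemma dvd_card_common_neighbours_iff_of_odd (hF : ringChar F ≠ 2) (j : ℕ)
    {x y : Fin (2 * j + 3) → F} (hxy : x ≠ y) :
    ringChar F * Fintype.card F ^ j ∣
      Nat.card {z // IsSquare ((x - z) ⬝ᵥ (x - z)) ∧ IsSquare ((y - z) ⬝ᵥ (y - z))} ↔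
    (x - y) ⬝ᵥ (x - y) = 0 := by
  classical
  set v := x - y with hv
  have hv0 : v ≠ 0 := sub_ne_zero.mpr hxy
  let S : Finset F := {a : F | IsSquare a}
  have hcard : Nat.card {z // IsSquare ((x - z) ⬝ᵥ (x - z)) ∧ IsSquare ((y - z) ⬝ᵥ (y - z))} =
      ∑ i ∈ S ×ˢ S, Nat.card {z : Fin (2 * j + 3) → F //
        z ⬝ᵥ z = i.1 ∧ 2 * (z ⬝ᵥ v) = i.1 + v ⬝ᵥ v - i.2} := by
    rw [Nat.card_congr ((Equiv.subLeft x).subtypeEquiv (q := fun z =>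
      IsSquare (z ⬝ᵥ z) ∧ IsSquare ((z - v) ⬝ᵥ (z - v))) fun z => by simp [hv]),
      Nat.card_eq_fintype_card, Fintype.card_subtype,
      Finset.card_eq_sum_card_fiberwise (f := fun z => (z ⬝ᵥ z, (z - v) ⬝ᵥ (z - v)))
        (t := S ×ˢ S) (fun z hz => by simpa [S] using hz)]
    refine Finset.sum_congr rfl fun i hi => ?_
    rw [Nat.card_eq_fintype_card, Fintype.card_subtype]
    congr 1
    ext z
    simp only [S, Finset.mem_product, Finset.mem_filter, Finset.mem_univ, true_and] at hi
    simp only [Finset.mem_filter, Finset.mem_univ, true_and, Prod.ext_iff]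
    have key : ∀ b, (z - v) ⬝ᵥ (z - v) = b ↔ 2 * (z ⬝ᵥ v) = z ⬝ᵥ z + v ⬝ᵥ v - b := by
      intro b
      rw [dotProduct_sub_self]
      constructor <;> intro h <;> linear_combination -h
    constructor
    · rintro ⟨-, h1, h2⟩
      exact ⟨h1, h1 ▸ (key _).mp h2⟩
    · rintro ⟨h1, h2⟩
      have h3 := (key i.2).mpr (h1 ▸ h2)
      exact ⟨⟨h1 ▸ hi.1, h3 ▸ hi.2⟩, h1, h3⟩
  have hS : (#(S ×ˢ S) : F) ≠ 0 := by
    rw [Finset.card_product, Nat.cast_mul]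
    exact mul_ne_zero (cast_card_isSquare_ne_zero hF) (cast_card_isSquare_ne_zero hF)
  rw [hcard, ringChar_mul_pow_dvd_sum_iff (S ×ˢ S) hS j _ _ (-(v ⬝ᵥ v))
    (fun i _ => card_filter_quadratic_one_linear hF j hv0 _ _)
    (fun i _ => cast_sum_quadraticChar_quadratic hF _ _ _), neg_eq_zero]

/-- In even dimension, the number of common neighbours of three points detects degeneracy of the
plane they span. -/
lemma dvd_card_common_neighbours_iff_of_even (hF : ringChar F ≠ 2) (j : ℕ)
    {x y w : Fin (2 * j + 4) → F} (hxy : x ≠ y) (hsq : IsSquare ((x - y) ⬝ᵥ (x - y)))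
    (hw : ¬IsSquare ((x - w) ⬝ᵥ (x - w))) :
    ringChar F * Fintype.card F ^ j ∣
      Nat.card {z // IsSquare ((x - z) ⬝ᵥ (x - z)) ∧ IsSquare ((y - z) ⬝ᵥ (y - z)) ∧
        IsSquare ((w - z) ⬝ᵥ (w - z))} ↔
    (x - y) ⬝ᵥ (x - y) = 0 ∧ (x - y) ⬝ᵥ (x - w) = 0 := by
  classical
  set v := x - y with hv
  set u := x - w with hu
  have hv0 : v ≠ 0 := sub_ne_zero.mpr hxy
  have hu0 : u ⬝ᵥ u ≠ 0 := fun h => hw (h ▸ IsSquare.zero)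
  have h2 : (2 : F) ≠ 0 := Ring.two_ne_zero hF
  have h4 : (4 : F) ≠ 0 := by
    rw [show (4 : F) = 2 * 2 by norm_num]; exact mul_ne_zero h2 h2
  have hind : ∀ s t : F, s • v + t • u = 0 → s = 0 ∧ t = 0 := by
    intro s t hst
    have ht : t = 0 := by
      by_contra ht
      apply hw
      have : u = (-(s / t)) • v := by
        rw [neg_smul, div_eq_inv_mul, mul_smul, ← smul_neg, ← eq_neg_of_add_eq_zero_right hst,
          inv_smul_smul₀ ht]
      rw [this, smul_dotProduct, dotProduct_smul, smul_eq_mul, smul_eq_mul, ← mul_assoc]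
      exact (IsSquare.mul_self _).mul hsq
    subst ht
    simpa [hv0] using hst
  let S : Finset F := {a : F | IsSquare a}
  have hcard : Nat.card {z // IsSquare ((x - z) ⬝ᵥ (x - z)) ∧ IsSquare ((y - z) ⬝ᵥ (y - z)) ∧
        IsSquare ((w - z) ⬝ᵥ (w - z))} =
      ∑ i ∈ S ×ˢ S ×ˢ S, Nat.card {z : Fin (2 * j + 4) → F //
        z ⬝ᵥ z = i.1 ∧ 2 * (z ⬝ᵥ v) = i.1 + v ⬝ᵥ v - i.2.1 ∧
          2 * (z ⬝ᵥ u) = i.1 + u ⬝ᵥ u - i.2.2} := by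
    rw [Nat.card_congr ((Equiv.subLeft x).subtypeEquiv (q := fun z =>
      IsSquare (z ⬝ᵥ z) ∧ IsSquare ((z - v) ⬝ᵥ (z - v)) ∧ IsSquare ((z - u) ⬝ᵥ (z - u)))
        fun z => by simp [hv, hu]),
      Nat.card_eq_fintype_card, Fintype.card_subtype,
      Finset.card_eq_sum_card_fiberwise
        (f := fun z => (z ⬝ᵥ z, (z - v) ⬝ᵥ (z - v), (z - u) ⬝ᵥ (z - u)))
        (t := S ×ˢ S ×ˢ S) (fun z hz => by simpa [S] using hz)]
    refine Finset.sum_congr rfl fun i hi => ?_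
    rw [Nat.card_eq_fintype_card, Fintype.card_subtype]
    congr 1
    ext z
    simp only [S, Finset.mem_product, Finset.mem_filter, Finset.mem_univ, true_and] at hi
    simp only [Finset.mem_filter, Finset.mem_univ, true_and, Prod.ext_iff]
    have key : ∀ v b, (z - v) ⬝ᵥ (z - v) = b ↔ 2 * (z ⬝ᵥ v) = z ⬝ᵥ z + v ⬝ᵥ v - b := by
      intro v b
      rw [dotProduct_sub_self]
      constructor <;> intro h <;> linear_combination -h
    constructor
    · rintro ⟨-, h1, h2, h3⟩
      exact ⟨h1, h1 ▸ (key _ _).mp h2, h1 ▸ (key _ _).mp h3⟩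
    · rintro ⟨h1, h2, h3⟩
      have h2' := (key v i.2.1).mpr (h1 ▸ h2)
      have h3' := (key u i.2.2).mpr (h1 ▸ h3)
      exact ⟨⟨h1 ▸ hi.1, h2' ▸ hi.2.1, h3' ▸ hi.2.2⟩, h1, h2', h3'⟩
  have hS0 := cast_card_isSquare_ne_zero (F := F) hF
  have hS : (#(S ×ˢ S ×ˢ S) : F) ≠ 0 := by
    rw [Finset.card_product, Finset.card_product, Nat.cast_mul, Nat.cast_mul]
    exact mul_ne_zero hS0 (mul_ne_zero hS0 hS0)
  rw [hcard, ringChar_mul_pow_dvd_sum_iff _ hS j _ _ (4 * ((v ⬝ᵥ u) ^ 2 - (v ⬝ᵥ v) * (u ⬝ᵥ u)))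
    (fun i _ => card_filter_quadratic_two_linear hF j hind hu0 _ _ _)
    (fun i _ => cast_sum_quadraticChar_quadratic hF _ _ _)]
  constructor
  · intro h
    have h' : (v ⬝ᵥ u) ^ 2 = (v ⬝ᵥ v) * (u ⬝ᵥ u) :=
      sub_eq_zero.mp ((mul_eq_zero.mp h).resolve_left h4)
    have hvv : v ⬝ᵥ v = 0 := by
      by_contra hvv
      apply hw
      have huu : u ⬝ᵥ u = (v ⬝ᵥ u) ^ 2 / (v ⬝ᵥ v) :=
        eq_div_of_mul_eq hvv (by rw [mul_comm]; exact h'.symm)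
      rw [huu]
      exact (IsSquare.sq _).div hsq
    rw [hvv, zero_mul] at h'
    exact ⟨hvv, pow_eq_zero_iff two_ne_zero |>.mp h'⟩
  · rintro ⟨h1, h2⟩
    simp [h1, h2]

/-- In even dimension, distance zero is characterised among square distances by the existence of
a suitable third point. -/
lemma dotProduct_self_eq_zero_iff_of_even (hF : ringChar F ≠ 2) (j : ℕ)
    {x y : Fin (2 * j + 4) → F} (hxy : x ≠ y) (hsq : IsSquare ((x - y) ⬝ᵥ (x - y))) :
    (x - y) ⬝ᵥ (x - y) = 0 ↔ ∃ w, ¬IsSquare ((x - w) ⬝ᵥ (x - w)) ∧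
      ringChar F * Fintype.card F ^ j ∣
        Nat.card {z // IsSquare ((x - z) ⬝ᵥ (x - z)) ∧ IsSquare ((y - z) ⬝ᵥ (y - z)) ∧
          IsSquare ((w - z) ⬝ᵥ (w - z))} := by
  constructor
  · intro h
    obtain ⟨a, ha⟩ := FiniteField.exists_nonsquare hF
    have ha0 : a ≠ 0 := by rintro rfl; exact ha IsSquare.zero
    obtain ⟨z, hz, hz'⟩ := exists_orthogonal_of_isotropic hF j (sub_ne_zero.mpr hxy) h ha0
    have hw : ¬IsSquare ((x - (x - z)) ⬝ᵥ (x - (x - z))) := by rwa [sub_sub_cancel, hz]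
    exact ⟨x - z, hw, (dvd_card_common_neighbours_iff_of_even hF j hxy hsq hw).mpr
      ⟨h, by rwa [sub_sub_cancel]⟩⟩
  · rintro ⟨w, hw, hdvd⟩
    exact ((dvd_card_common_neighbours_iff_of_even hF j hxy hsq hw).mp hdvd).1

end CommonNeighbours

/-- Let `p` be an odd prime, `q = p^h`, `n ≥ 3`. Every
integral automorphism `γ` of `𝔽_q^n` preserves distance zero:
`∑ (x_i - y_i)² = 0 ↔ ∑ (γ(x)_i - γ(y)_i)² = 0`. -/
theorem integral_automorphism_preserves_zero_distance
    (p h n : ℕ) (hp : p.Prime) (hodd : Odd p) (hn : 3 ≤ n)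
    (q : ℕ) (hq : q = p ^ h)
    (F : Type) [Field F] [Fintype F] (hF : Fintype.card F = q)
    (γ : (Fin n → F) → (Fin n → F)) (hγ : Function.Bijective γ)
    (hint : ∀ x y : Fin n → F,
      IsSquare (∑ j, (x j - y j) ^ 2) ↔ IsSquare (∑ j, (γ x j - γ y j) ^ 2)) :
    ∀ x y : Fin n → F,
      (∑ j, (x j - y j) ^ 2) = 0 ↔ (∑ j, (γ x j - γ y j) ^ 2) = 0 := by
  classical
  have hchar : ringChar F ≠ 2 := by
    rw [ne_eq, FiniteField.even_card_iff_char_two, hF, hq]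
    have := Nat.odd_iff.mp (hodd.pow (n := h))
    omega
  have hdot : ∀ x y : Fin n → F, ∑ j, (x j - y j) ^ 2 = (x - y) ⬝ᵥ (x - y) := by
    intro x y
    simp [dotProduct, sq]
  simp only [hdot] at hint ⊢
  intro x y
  rcases eq_or_ne x y with rfl | hxy
  · simp
  have hγxy : γ x ≠ γ y := hγ.injective.ne hxy
  rcases Nat.even_or_odd n with he | ho
  · obtain ⟨j, rfl⟩ : ∃ j, n = 2 * j + 4 := by
      obtain ⟨k, hk⟩ := he
      exact ⟨k - 2, by omega⟩
    by_cases hsq : IsSquare ((x - y) ⬝ᵥ (x - y))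
    · rw [dotProduct_self_eq_zero_iff_of_even hchar j hxy hsq,
        dotProduct_self_eq_zero_iff_of_even hchar j hγxy ((hint x y).mp hsq)]
      refine Iff.trans ?_ hγ.surjective.exists.symm
      refine exists_congr fun w => and_congr (not_congr (hint x w)) ?_
      rw [Nat.card_congr ((Equiv.ofBijective γ hγ).subtypeEquiv (q := fun z =>
        IsSquare ((γ x - z) ⬝ᵥ (γ x - z)) ∧ IsSquare ((γ y - z) ⬝ᵥ (γ y - z)) ∧
          IsSquare ((γ w - z) ⬝ᵥ (γ w - z))) fun z =>
        and_congr (hint x z) (and_congr (hint y z) (hint w z)))]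
    · have hsq' := (hint x y).not.mp hsq
      exact iff_of_false (fun h0 => hsq (h0 ▸ IsSquare.zero)) fun h0 => hsq' (h0 ▸ IsSquare.zero)
  · obtain ⟨j, rfl⟩ : ∃ j, n = 2 * j + 3 := by
      obtain ⟨k, hk⟩ := ho
      exact ⟨k - 1, by omega⟩
    rw [← dvd_card_common_neighbours_iff_of_odd hchar j hxy,
      ← dvd_card_common_neighbours_iff_of_odd hchar j hγxy,
      Nat.card_congr ((Equiv.ofBijective γ hγ).subtypeEquiv (q := fun z =>
        IsSquare ((γ x - z) ⬝ᵥ (γ x - z)) ∧ IsSquare ((γ y - z) ⬝ᵥ (γ y - z))) fun z =>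
        and_congr (hint x z) (hint y z))]
end

section
/- Let p be an odd prime, q = p^h, and n ≥ 3. Every integral automorphism γ of 𝔽_q^n preserves the cones of the standard bilinear form: for every a ∈ 𝔽_q^n, the image under γ of the set { x ∈ 𝔽_q^n : Σ_{i=1}^n (x_i − a_i)² = 0 } equals { x ∈ 𝔽_q^n : Σ_{i=1}^n (x_i − γ(a)_i)² = 0 }. -/
section PairCount

variable {F V : Type*} [Field F] [AddCommGroup V] [Module F V]

lemma apply_add_smul_self {B : LinearMap.BilinForm F V}
    {y : V} (hB : ∀ x y, B x y = B y x) (hy : B y y = 0) (u : V) (c : F) :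
    B (u + c • y) (u + c • y) = B u u + 2 * B y u * c := by
  simp only [map_add, map_smul, LinearMap.add_apply, LinearMap.smul_apply, smul_eq_mul, hy, hB u y]
  ring

lemma surjective_of_ne_zero {B : LinearMap.BilinForm F V} {y : V}
    (hnd : ∀ x, (∀ y, B x y = 0) → x = 0) (hy : y ≠ 0) :
    Function.Surjective (B y) :=
  LinearMap.surjective fun h => hy (hnd y fun v => by rw [h, LinearMap.zero_apply])

variable [Fintype F]

lemma sum_comp_sq [DecidableEq F] (hF : ringChar F ≠ 2) (f : F → ℤ) :
    ∑ a : F, f (a ^ 2) = ∑ x : F, (quadraticChar F x + 1) * f x := by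
  rw [← Finset.sum_fiberwise (s := Finset.univ) (g := fun a : F => a ^ 2)]
  refine Finset.sum_congr rfl fun x _ => ?_
  rw [← quadraticChar_card_sqrts hF x, Finset.sum_congr rfl (g := fun _ => f x)
    (fun a ha => by rw [(Finset.mem_filter.mp ha).2]), Finset.sum_const, nsmul_eq_mul]
  congr 3
  ext a
  simp

lemma sum_quadraticChar_mul_sub [DecidableEq F] (hF : ringChar F ≠ 2) (s : F) :
    ∑ x : F, quadraticChar F x * quadraticChar F (s - x) =
      quadraticChar F (-1) * (Fintype.card F * (if s = 0 then 1 else 0) - 1) := by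
  have hone : ∑ x : F, quadraticChar F x * quadraticChar F (1 - x) = -quadraticChar F (-1) := by
    have h := jacobiSum_nontrivial_inv (quadraticChar_ne_one hF)
    rwa [(quadraticChar_isQuadratic F).inv] at h
  rcases eq_or_ne s 0 with rfl | hs
  · have h (x : F) : quadraticChar F x * quadraticChar F (0 - x) =
        quadraticChar F (-1) * (1 - if x = 0 then 1 else 0) := by
      rcases eq_or_ne x 0 with rfl | hx
      · simp
      · rw [zero_sub, neg_eq_neg_one_mul, map_mul, if_neg hx, mul_left_comm, ← sq,
          quadraticChar_sq_one hx, sub_zero]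
    simp_rw [h, ← Finset.mul_sum, Finset.sum_sub_distrib]
    simp
  · rw [← Equiv.sum_comp (Equiv.mulLeft₀ s hs)]
    have h (x : F) : quadraticChar F (s * x) * quadraticChar F (s - s * x) =
        quadraticChar F x * quadraticChar F (1 - x) := by
      rw [← mul_one_sub, map_mul, map_mul]
      linear_combination (quadraticChar F x * quadraticChar F (1 - x)) * quadraticChar_sq_one hs
    refine (Finset.sum_congr rfl fun x _ => h x).trans ?_
    rw [hone, if_neg hs, mul_zero, zero_sub, mul_neg_one]

/-- The fibre sizes of `g` are those of a nondegenerate quadratic form in `2 * k` variables,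
phrased through sums of functions composed with `g`. -/
def HasEvenFormCount {X : Type*} [Fintype X] (g : X → F) (k : ℕ) : Prop :=
  ∃ ε : ℤ, (ε = 1 ∨ ε = -1) ∧ ∀ f : F → ℤ, Fintype.card F * ∑ x, f (g x) =
    (Fintype.card F : ℤ) ^ (2 * k) * ∑ s, f s +
      ε * (Fintype.card F : ℤ) ^ k * (Fintype.card F * f 0 - ∑ s, f s)

lemma sum_binary_form [DecidableEq F] (hF : ringChar F ≠ 2) {c d : F} (hc : c ≠ 0) (hd : d ≠ 0) :
    ∃ ε : ℤ, (ε = 1 ∨ ε = -1) ∧ ∀ f : F → ℤ, ∑ a : F, ∑ b : F, f (c * a ^ 2 + d * b ^ 2) =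
      Fintype.card F * ∑ s, f s + ε * (Fintype.card F * f 0 - ∑ s, f s) := by
  refine ⟨quadraticChar F (c⁻¹ * d⁻¹ * (-1)), quadraticChar_dichotomy (by simp [hc, hd]),
    fun f => ?_⟩
  have key (s : F) : ∑ x : F, (quadraticChar F (c⁻¹ * x) + 1) *
      (quadraticChar F (d⁻¹ * (s - x)) + 1) =
      quadraticChar F (c⁻¹ * d⁻¹ * (-1)) * (Fintype.card F * (if s = 0 then 1 else 0) - 1) +
        Fintype.card F := by
    have h1 : ∑ x : F, quadraticChar F (s - x) = 0 := by
      rw [← quadraticChar_sum_zero hF]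
      exact Equiv.sum_comp (Equiv.subLeft s) _
    simp_rw [map_mul, mul_assoc, ← sum_quadraticChar_mul_sub hF s]
    simp only [add_mul, mul_add, Finset.sum_add_distrib, one_mul, mul_one, ← Finset.mul_sum,
      quadraticChar_sum_zero hF, h1, mul_assoc, mul_left_comm (quadraticChar F _)
        (quadraticChar F d⁻¹)]
    simp
  calc ∑ a : F, ∑ b : F, f (c * a ^ 2 + d * b ^ 2)
      = ∑ x : F, ∑ y : F, (quadraticChar F x + 1) * (quadraticChar F y + 1) *
          f (c * x + d * y) := by
        rw [sum_comp_sq hF fun x => ∑ b : F, f (c * x + d * b ^ 2)]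
        refine Finset.sum_congr rfl fun x _ => ?_
        rw [sum_comp_sq hF fun y => f (c * x + d * y), Finset.mul_sum]
        simp_rw [mul_assoc]
    _ = ∑ x : F, ∑ s : F, (quadraticChar F (c⁻¹ * x) + 1) *
          (quadraticChar F (d⁻¹ * (s - x)) + 1) * f s := by
        refine Fintype.sum_equiv (Equiv.mulLeft₀ c hc) _ _ fun x => ?_
        refine Fintype.sum_equiv ((Equiv.mulLeft₀ d hd).trans (Equiv.addLeft (c * x))) _ _
          fun y => ?_
        simp [hc, hd]
    _ = _ := by
        rw [Finset.sum_comm]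
        simp_rw [← Finset.sum_mul, key, add_mul, Finset.sum_add_distrib, mul_assoc, sub_mul,
          ← Finset.mul_sum, Finset.sum_sub_distrib, mul_assoc, ← Finset.mul_sum]
        simp
        ring

lemma sum_comp_weightedSum_succ_succ {m : ℕ} (w : Fin (m + 2) → F) (f : F → ℤ) :
    ∑ v : Fin (m + 2) → F, f (∑ i, w i * v i ^ 2) =
      ∑ a : F, ∑ b : F, ∑ v : Fin m → F,
        f ((w 0 * a ^ 2 + w 1 * b ^ 2) + ∑ i, w i.succ.succ * v i ^ 2) := by
  rw [← Equiv.sum_comp (Fin.consEquiv fun _ : Fin (m + 2) => F), Fintype.sum_prod_type]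
  refine Finset.sum_congr rfl fun a _ => ?_
  rw [← Equiv.sum_comp (Fin.consEquiv fun _ : Fin (m + 1) => F), Fintype.sum_prod_type]
  refine Finset.sum_congr rfl fun b _ => Finset.sum_congr rfl fun v _ => ?_
  simp [Fin.consEquiv, Fin.sum_univ_succ, add_assoc]

lemma hasEvenFormCount_weightedSum (hF : ringChar F ≠ 2) (k : ℕ) (w : Fin (2 * k) → Fˣ) :
    HasEvenFormCount (fun v : Fin (2 * k) → F => ∑ i, (w i : F) * v i ^ 2) k := by
  classical
  induction k with
  | zero => exact ⟨1, Or.inl rfl, fun f => by simp⟩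
  | succ k ih =>
    obtain ⟨ε, hε, h⟩ := ih (fun i => w i.succ.succ)
    obtain ⟨ε', hε', h'⟩ := sum_binary_form hF (w 0).ne_zero (w 1).ne_zero
    refine ⟨ε * ε', by rcases hε with rfl | rfl <;> rcases hε' with rfl | rfl <;> simp,
      fun f => ?_⟩
    have hshift (c : F) : ∑ s, f (c + s) = ∑ s, f s := Equiv.sum_comp (Equiv.addLeft c) f
    rw [show ∑ v : Fin (2 * (k + 1)) → F, f (∑ i, (w i : F) * v i ^ 2) = _ from
      sum_comp_weightedSum_succ_succ (m := 2 * k) (fun i => (w i : F)) f]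
    simp_rw [Finset.mul_sum, ← Finset.mul_sum (s := (Finset.univ : Finset (Fin (2 * k) → F)))]
    simp_rw [fun c : F => h fun s => f (c + s), hshift, add_zero]
    simp only [Finset.sum_add_distrib, Finset.sum_sub_distrib, mul_sub, ← Finset.mul_sum, h']
    simp
    ring

lemma hasEvenFormCount_bilinForm [Fintype V] (hF : ringChar F ≠ 2) {B : LinearMap.BilinForm F V}
    (hB : ∀ x y, B x y = B y x) (hnd : ∀ x, (∀ y, B x y = 0) → x = 0) {k : ℕ}
    (hk : Module.finrank F V = 2 * k) : HasEvenFormCount (fun v => B v v) k := by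
  have : Invertible (2 : F) := invertibleOfNonzero (Ring.two_ne_zero hF)
  have hsep : (QuadraticMap.associated (R := F)
      (LinearMap.BilinMap.toQuadraticMap B)).SeparatingLeft := by
    rw [QuadraticMap.associated_left_inverse F hB]
    exact hnd
  obtain ⟨w, ⟨e⟩⟩ : ∃ w : Fin (2 * k) → Fˣ, QuadraticMap.Equivalent
      (LinearMap.BilinMap.toQuadraticMap B) (QuadraticMap.weightedSumSquares F w) :=
    hk ▸ QuadraticForm.equivalent_weightedSumSquares_units_of_nondegenerate' _ hsep
  obtain ⟨ε, hε, h⟩ := hasEvenFormCount_weightedSum hF k w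
  refine ⟨ε, hε, fun f => ?_⟩
  rw [← h f, ← Equiv.sum_comp e.toEquiv]
  congr! 3 with v
  have h' := e.map_app v
  rw [QuadraticMap.weightedSumSquares_apply] at h'
  simpa [Units.smul_def, sq] using h'.symm

/-- The sign `1` on squares (including `0`) and `-1` on nonsquares. -/
noncomputable def squareSign (t : F) : ℤ := open Classical in if IsSquare t then 1 else -1

lemma squareSign_mul_self (t : F) : squareSign t * squareSign t = 1 := by
  unfold squareSign
  split_ifs <;> rfl

lemma sum_squareSign (hF : ringChar F ≠ 2) : ∑ t : F, squareSign t = 1 := by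
  classical
  have h (t : F) : squareSign t = quadraticChar F t + if t = 0 then 1 else 0 := by
    rw [quadraticChar_apply, quadraticCharFun]
    unfold squareSign
    split_ifs <;> simp_all
  simp [h, Finset.sum_add_distrib, quadraticChar_sum_zero hF, -quadraticChar_apply]

lemma sum_squareSign_affine (hF : ringChar F ≠ 2) (a : F) :
    ∑ t : F, squareSign (a - 2 * t) = 1 := by
  rw [← sum_squareSign hF]
  exact Equiv.sum_comp ((Equiv.mulLeft₀ 2 (Ring.two_ne_zero hF)).trans (Equiv.subLeft a)) squareSign

lemma sum_comp_linearMap {W : Type*} [AddCommGroup W] [Module F W] [Fintype V] [Fintype W]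
    (ℓ : V →ₗ[F] W) (hℓ : Function.Surjective ℓ) (f : W → ℤ) :
    ∃ r, Module.finrank F V = Module.finrank F W + r ∧
      ∑ v, f (ℓ v) = (Fintype.card F : ℤ) ^ r * ∑ w, f w := by
  classical
  obtain ⟨s, hs⟩ := ℓ.exists_rightInverse_of_surjective (LinearMap.range_eq_top.mpr hℓ)
  have hs' (w : W) : ℓ (s w) = w := LinearMap.congr_fun hs w
  refine ⟨Module.finrank F (LinearMap.ker ℓ), ?_, ?_⟩
  · rw [← ℓ.finrank_range_add_finrank_ker, LinearMap.range_eq_top.mpr hℓ, finrank_top]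
  · let e : W × LinearMap.ker ℓ ≃ V :=
      { toFun p := s p.1 + p.2
        invFun v := (ℓ v, ⟨v - s (ℓ v), by simp [hs']⟩)
        left_inv p := by ext <;> simp [hs']
        right_inv v := by simp }
    rw [← Equiv.sum_comp e, Fintype.sum_prod_type]
    have (w : W) (k : LinearMap.ker ℓ) : f (ℓ (e (w, k))) = f w := by simp [e, hs']
    simp_rw [this, Finset.sum_const, ← Finset.smul_sum, Finset.card_univ,
      Module.card_eq_pow_finrank (K := F) (V := LinearMap.ker ℓ)]
    simp

/-- The hypotheses say that `y` is a dual family of `x` inside its span, i.e. that `x` is linearly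
independent with nondegenerate span. -/
lemma not_dvd_sum_of_dual [Fintype V] (hF : ringChar F ≠ 2) {B : LinearMap.BilinForm F V}
    (hB : ∀ x y, B x y = B y x) (hnd : ∀ x, (∀ y, B x y = 0) → x = 0)
    {ι : Type*} [Fintype ι] [DecidableEq ι] {x y : ι → V}
    (hdual : ∀ i j, B (y i) (x j) = if i = j then 1 else 0)
    (hspan : ∀ i, y i ∈ Submodule.span F (Set.range x)) {k : ℕ} (hk : 1 ≤ k)
    (hV : Module.finrank F V = 2 * k + Fintype.card ι) :
    ¬ (Fintype.card F : ℤ) ^ k ∣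
      ∑ u : V, squareSign (B u u) * ∏ i, squareSign (B (u - x i) (u - x i)) := by
  classical
  let ℓ : V →ₗ[F] ι → F := LinearMap.pi fun i => B (x i)
  have hsum (t : ι → F) (j : ι) : B (x j) (∑ i, t i • y i) = t j := by
    simp [map_sum, hB (x j), hdual]
  have hker (w : LinearMap.ker ℓ) (i : ι) : B (x i) w = 0 := congr_fun w.2 i
  have hkery (w : LinearMap.ker ℓ) (i : ι) : B (y i) w = 0 := by
    have : Submodule.span F (Set.range x) ≤ LinearMap.ker (B.flip w) :=
      Submodule.span_le.mpr (by rintro _ ⟨j, rfl⟩; exact hker w j)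
    exact this (hspan i)
  let e : (ι → F) × LinearMap.ker ℓ ≃ V :=
    { toFun p := ∑ i, p.1 i • y i + p.2
      invFun v := (ℓ v, ⟨v - ∑ i, ℓ v i • y i, by
        ext j
        simp only [map_sub, ℓ, LinearMap.pi_apply, hsum]
        simp⟩)
      left_inv p := by
        have : ℓ (∑ i, p.1 i • y i + p.2) = p.1 := by
          ext j
          simp only [ℓ, LinearMap.pi_apply, map_add, hsum, hker, add_zero]
        ext1
        · exact this
        · ext1
          simp [this]
      right_inv v := by simp }
  have hnd' (w : LinearMap.ker ℓ) (h : ∀ w' : LinearMap.ker ℓ, B w w' = 0) : w = 0 := by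
    refine Subtype.ext (hnd _ fun v => ?_)
    obtain ⟨⟨t, w'⟩, rfl⟩ := e.surjective v
    simp [e, hB w, hkery, fun w' : LinearMap.ker ℓ => (hB w' w).trans (h w')]
  have hfin : Module.finrank F (LinearMap.ker ℓ) = 2 * k := by
    have h := ℓ.finrank_range_add_finrank_ker
    rw [LinearMap.range_eq_top.mpr fun t => ⟨∑ i, t i • y i, funext fun j => hsum t j⟩,
      finrank_top, Module.finrank_fintype_fun_eq_card, hV] at h
    lia
  obtain ⟨ε, hε, hcount⟩ := hasEvenFormCount_bilinForm (B := B.restrict (LinearMap.ker ℓ)) hF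
    (fun _ _ => hB _ _) hnd' hfin
  set q : ℤ := (Fintype.card F : ℤ) with hq
  let c (t : ι → F) : F := B (∑ i, t i • y i) (∑ i, t i • y i)
  let f (t : ι → F) (s : F) : ℤ :=
    squareSign (c t + s) * ∏ i, squareSign (c t + s + B (x i) (x i) - 2 * t i)
  have hsumker (t : ι → F) (w : LinearMap.ker ℓ) : B (∑ i, t i • y i) w = 0 := by
    simp [hkery]
  have hterm (t : ι → F) (w : LinearMap.ker ℓ) :
      squareSign (B (e (t, w)) (e (t, w))) *
        ∏ i, squareSign (B (e (t, w) - x i) (e (t, w) - x i)) = f t (B w w) := by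
    have h0 : B (e (t, w)) (e (t, w)) = c t + B w w := by
      simp only [e, c, Equiv.coe_fn_mk, map_add, LinearMap.add_apply, hsumker, hB w]
      ring
    have h1 (i : ι) : B (e (t, w)) (x i) = t i := by
      rw [hB]
      simp only [e, Equiv.coe_fn_mk, map_add, hsum, hker, add_zero]
    simp only [f, map_sub, LinearMap.sub_apply, h0, h1, hB (x _) (e _)]
    congr! 3
    ring
  have hf : ∑ t, ∑ s, f t s = 1 := by
    calc ∑ t, ∑ s, f t s
        = ∑ t : ι → F, ∑ s, squareSign s * ∏ i, squareSign (s + B (x i) (x i) - 2 * t i) :=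
          Finset.sum_congr rfl fun t _ => Equiv.sum_comp (Equiv.addLeft (c t))
            fun s => squareSign s * ∏ i, squareSign (s + B (x i) (x i) - 2 * t i)
      _ = 1 := by
          rw [Finset.sum_comm]
          have hprod (s : F) :
              ∑ t : ι → F, ∏ i, squareSign (s + B (x i) (x i) - 2 * t i) = 1 := by
            rw [← Fintype.piFinset_univ, ← Finset.prod_univ_sum (fun _ => Finset.univ)
              fun i t => squareSign (s + B (x i) (x i) - 2 * t)]
            simp [sum_squareSign_affine hF]
          simp [← Finset.mul_sum, hprod, sum_squareSign hF]
  intro hdvd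
  have hmain : q * ∑ u : V, squareSign (B u u) * ∏ i, squareSign (B (u - x i) (u - x i)) =
      q ^ (2 * k) - ε * q ^ k + ε * q ^ (k + 1) * ∑ t, f t 0 := by
    rw [← Equiv.sum_comp e, Fintype.sum_prod_type, Finset.mul_sum]
    simp_rw [hterm]
    have hcount' (t : ι → F) := hcount (f t)
    simp only [LinearMap.BilinForm.restrict_apply, LinearMap.domRestrict_apply] at hcount'
    simp_rw [Finset.mul_sum, ← Finset.mul_sum (s := (Finset.univ : Finset (LinearMap.ker ℓ))),
      hcount', Finset.sum_add_distrib, ← Finset.mul_sum, Finset.sum_sub_distrib, hf,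
      ← Finset.mul_sum]
    ring
  have hq1 : 1 < q := by
    rw [hq]
    exact_mod_cast Fintype.one_lt_card
  have h1 : q ^ (k + 1) ∣ ε * q ^ k := by
    have h2 : q ^ (k + 1) ∣ q ^ (2 * k) := pow_dvd_pow q (by lia)
    have h3 := mul_dvd_mul_left q hdvd
    rw [hmain, ← pow_succ'] at h3
    rw [show ε * q ^ k = q ^ (2 * k) + (ε * ∑ t, f t 0) * q ^ (k + 1) -
      (q ^ (2 * k) - ε * q ^ k + ε * q ^ (k + 1) * ∑ t, f t 0) by ring]
    exact dvd_sub (dvd_add h2 (Dvd.intro_left _ rfl)) h3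
  have h5 : q ^ k * q ∣ q ^ k * 1 := by
    rw [← pow_succ, mul_one]
    rcases hε with rfl | rfl <;> simpa using h1
  have h6 := Int.le_of_dvd one_pos (Int.dvd_of_mul_dvd_mul_left (by positivity) h5)
  lia

section Isotropic

variable [Fintype V] {B : LinearMap.BilinForm F V} {y : V}

lemma card_mul_sum_eq_sum_translate (y : V) (G : V → ℤ) :
    Fintype.card F * ∑ u, G u = ∑ u, ∑ c : F, G (u + c • y) := by
  rw [Finset.sum_comm]
  have (c : F) : ∑ u, G (u + c • y) = ∑ u, G u := Equiv.sum_comp (Equiv.addRight (c • y)) G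
  simp [this]

lemma sum_comp_add_mul {a t : F} (ht : t ≠ 0) (f : F → ℤ) : ∑ c, f (a + t * c) = ∑ s, f s :=
  Equiv.sum_comp ((Equiv.mulLeft₀ t ht).trans (Equiv.addLeft a)) f

open Classical in
lemma card_mul_sum_comp_form (hF : ringChar F ≠ 2) (hB : ∀ x y, B x y = B y x) (hyy : B y y = 0)
    (f : F → ℤ) : Fintype.card F * ∑ u, f (B u u) =
      Fintype.card F * ∑ u, (if B y u = 0 then f (B u u) else 0) +
        (∑ u, if B y u = 0 then 0 else 1) * ∑ s, f s := by
  rw [card_mul_sum_eq_sum_translate y, Finset.mul_sum, Finset.sum_mul, ← Finset.sum_add_distrib]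
  refine Finset.sum_congr rfl fun u _ => ?_
  simp_rw [apply_add_smul_self hB hyy]
  split_ifs with ht
  · simp [ht]
  · rw [sum_comp_add_mul (mul_ne_zero (Ring.two_ne_zero hF) ht) f]
    simp

lemma dvd_sum_of_isotropic (hF : ringChar F ≠ 2) (hB : ∀ x y, B x y = B y x)
    (hnd : ∀ x, (∀ y, B x y = 0) → x = 0) (hy : y ≠ 0) (hyy : B y y = 0) {k : ℕ} (hk : 1 ≤ k)
    (hV : Module.finrank F V = 2 * k + 1) :
    (Fintype.card F : ℤ) ^ k ∣
      ∑ u : V, squareSign (B u u) * squareSign (B (u - y) (u - y)) := by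
  classical
  let A (t : F) : ℤ := if t = 0 then Fintype.card F else ∑ s, squareSign s * squareSign (s - 2 * t)
  obtain ⟨r, hr, hsum⟩ := sum_comp_linearMap (B y) (surjective_of_ne_zero hnd hy) A
  have hA : Fintype.card F * ∑ u : V, squareSign (B u u) * squareSign (B (u - y) (u - y)) =
      ∑ u, A (B y u) := by
    rw [card_mul_sum_eq_sum_translate y]
    refine Finset.sum_congr rfl fun u _ => ?_
    have h (c : F) : B (u + c • y - y) (u + c • y - y) = B u u + 2 * B y u * c - 2 * B y u := by
      rw [show u + c • y - y = u + (c - 1) • y by module, apply_add_smul_self hB hyy]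
      ring
    simp_rw [h, apply_add_smul_self hB hyy, A]
    split_ifs with ht
    · simp [ht, squareSign_mul_self]
    · exact sum_comp_add_mul (mul_ne_zero (Ring.two_ne_zero hF) ht)
        fun s => squareSign s * squareSign (s - 2 * B y u)
  rw [Module.finrank_self, hV] at hr
  refine (mul_dvd_mul_iff_left (a := (Fintype.card F : ℤ)) (by simp)).mp ?_
  rw [hA, hsum, ← pow_succ']
  exact Dvd.dvd.mul_right (pow_dvd_pow _ (by lia)) _

open Classical in
lemma dvd_sum_orthogonal (hF : ringChar F ≠ 2) (hB : ∀ x y, B x y = B y x)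
    (hnd : ∀ x, (∀ y, B x y = 0) → x = 0) (hy : y ≠ 0) (hyy : B y y = 0) {k : ℕ}
    (hV : Module.finrank F V = 2 * (k + 1)) :
    (Fintype.card F : ℤ) ^ (k + 1) ∣
      Fintype.card F * ∑ u, if B y u = 0 then squareSign (B u u) else 0 := by
  obtain ⟨r, hr, hsum⟩ := sum_comp_linearMap (B y) (surjective_of_ne_zero hnd hy)
    fun t => if t = 0 then 0 else 1
  obtain ⟨ε, -, hε⟩ := hasEvenFormCount_bilinForm hF hB hnd hV
  have h := card_mul_sum_comp_form hF hB hyy squareSign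
  rw [hε squareSign, hsum, ← sub_eq_iff_eq_add] at h
  rw [Module.finrank_self, hV] at hr
  rw [← h]
  refine dvd_sub (dvd_add ?_ ?_) ?_
  · exact (pow_dvd_pow _ (by lia)).mul_right _
  · exact (Dvd.intro_left _ rfl).mul_right _
  · exact ((pow_dvd_pow _ (by lia)).mul_right _).mul_right _

lemma exists_orthogonal_apply_self_eq (hF : ringChar F ≠ 2) (hB : ∀ x y, B x y = B y x)
    (hnd : ∀ x, (∀ y, B x y = 0) → x = 0) (hy : y ≠ 0) (hyy : B y y = 0) {k : ℕ} (hk : 1 ≤ k)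
    (hV : Module.finrank F V = 2 * (k + 1)) {ν : F} (hν : ν ≠ 0) :
    ∃ z, B y z = 0 ∧ B z z = ν := by
  classical
  by_contra! hne
  obtain ⟨r, hr, hsum⟩ := sum_comp_linearMap (B y) (surjective_of_ne_zero hnd hy)
    fun t => if t = 0 then 0 else 1
  obtain ⟨ε, hε', hε⟩ := hasEvenFormCount_bilinForm hF hB hnd hV
  have h := card_mul_sum_comp_form hF hB hyy fun s => if s = ν then 1 else 0
  have hzero : (∑ u, if B y u = 0 then (if B u u = ν then (1 : ℤ) else 0) else 0) = 0 :=
    Finset.sum_eq_zero fun u _ => by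
      split_ifs with h1 h2
      · exact absurd h2 (hne u h1)
      all_goals rfl
  have hcard : (∑ t : F, if t = 0 then (0 : ℤ) else 1) = Fintype.card F - 1 := by
    have (t : F) : (if t = 0 then (0 : ℤ) else 1) = 1 - if t = 0 then 1 else 0 := by
      split_ifs <;> rfl
    simp [this, Finset.sum_sub_distrib]
  rw [hε fun s => if s = ν then 1 else 0, hsum, hzero, hcard] at h
  rw [Module.finrank_self, hV] at hr
  obtain rfl : r = 2 * k + 1 := by lia
  simp only [Finset.sum_ite_eq', Finset.mem_univ, if_true, hν.symm, if_false] at h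
  set q : ℤ := (Fintype.card F : ℤ) with hq
  have hq1 : 1 < q := by
    rw [hq]
    exact_mod_cast Fintype.one_lt_card
  have hqk : 1 < q ^ k := one_lt_pow₀ hq1 (by lia)
  have h1 : q ^ (k + 1) * ε = q ^ (k + 1) * q ^ k := by
    linear_combination -h
  have h2 := mul_left_cancel₀ (by positivity) h1
  lia

lemma dvd_sum_of_isotropic_of_orthogonal (hF : ringChar F ≠ 2) (hB : ∀ x y, B x y = B y x)
    (hnd : ∀ x, (∀ y, B x y = 0) → x = 0) (hy : y ≠ 0) (hyy : B y y = 0) {z : V}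
    (hyz : B y z = 0) (hzz : B z z ≠ 0) {k : ℕ} (hk : 1 ≤ k)
    (hV : Module.finrank F V = 2 * (k + 1)) :
    (Fintype.card F : ℤ) ^ k ∣ ∑ u : V, squareSign (B u u) *
      (squareSign (B (u - y) (u - y)) * squareSign (B (u - z) (u - z))) := by
  classical
  let G (p : F × F) : ℤ := if p.1 = 0 then 0 else
    ∑ s, squareSign s * (squareSign (s - 2 * p.1) * squareSign (s - 2 * p.2 + B z z))
  have hsurj : Function.Surjective ((B y).prod (B z)) := by
    rintro ⟨t, r⟩
    obtain ⟨w, hw⟩ := surjective_of_ne_zero hnd hy t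
    refine ⟨w + ((r - B z w) / B z z) • z, ?_⟩
    simp [hw, hyz, hzz]
  obtain ⟨r, hr, hsum⟩ := sum_comp_linearMap _ hsurj G
  have htranslate : (∑ u, if B y u = 0 then squareSign (B (u - z) (u - z)) else 0) =
      ∑ u, if B y u = 0 then squareSign (B u u) else 0 := by
    rw [← Equiv.sum_comp (Equiv.addRight z)]
    simp [hyz]
  have hG : Fintype.card F * ∑ u : V, squareSign (B u u) *
      (squareSign (B (u - y) (u - y)) * squareSign (B (u - z) (u - z))) =
      ∑ u, G (B y u, B z u) +
        Fintype.card F * ∑ u, if B y u = 0 then squareSign (B (u - z) (u - z)) else 0 := by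
    rw [card_mul_sum_eq_sum_translate y, Finset.mul_sum, ← Finset.sum_add_distrib]
    refine Finset.sum_congr rfl fun u _ => ?_
    have h (c : F) : B (u + c • y - y) (u + c • y - y) = B u u + 2 * B y u * c - 2 * B y u := by
      rw [show u + c • y - y = u + (c - 1) • y by module, apply_add_smul_self hB hyy]
      ring
    have h' (c : F) : B (u + c • y - z) (u + c • y - z) =
        B u u + 2 * B y u * c - 2 * B z u + B z z := by
      rw [show u + c • y - z = (u - z) + c • y by module, apply_add_smul_self hB hyy]
      simp only [map_sub, LinearMap.sub_apply, hyz, hB u z]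
      ring
    simp only [G]
    split_ifs with ht
    · have h'' (c : F) : B (u + c • y - z) (u + c • y - z) = B (u - z) (u - z) := by
        rw [show u + c • y - z = (u - z) + c • y by module, apply_add_smul_self hB hyy]
        simp [ht, hyz]
      simp_rw [h, h'', apply_add_smul_self hB hyy, ht, ← mul_assoc]
      simp [squareSign_mul_self]
    · simp_rw [h, h', apply_add_smul_self hB hyy]
      simpa using sum_comp_add_mul (mul_ne_zero (Ring.two_ne_zero hF) ht) fun s =>
        squareSign s * (squareSign (s - 2 * B y u) * squareSign (s - 2 * B z u + B z z))
  rw [Module.finrank_prod, Module.finrank_self, hV] at hr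
  refine (mul_dvd_mul_iff_left (a := (Fintype.card F : ℤ)) (by simp)).mp ?_
  rw [hG, htranslate, ← pow_succ']
  refine dvd_add ?_ (dvd_sum_orthogonal hF hB hnd hy hyy hV)
  exact hsum ▸ (pow_dvd_pow _ (by lia)).mul_right _

end Isotropic

section Integral

variable [Fintype V] {B : LinearMap.BilinForm F V} {γ : V → V}

lemma sum_squareSign_eq_of_integral (hγ : Function.Bijective γ)
    (hint : ∀ x y, IsSquare (B (x - y) (x - y)) ↔ IsSquare (B (γ x - γ y) (γ x - γ y)))
    {ι : Type*} [Fintype ι] (a : V) (x : ι → V) :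
    ∑ u, squareSign (B u u) * ∏ i, squareSign (B (u - (x i - a)) (u - (x i - a))) =
      ∑ u, squareSign (B u u) *
        ∏ i, squareSign (B (u - (γ (x i) - γ a)) (u - (γ (x i) - γ a))) := by
  have hsign (u v : V) : squareSign (B (γ u - γ v) (γ u - γ v)) =
      squareSign (B (u - v) (u - v)) := by
    classical
    unfold squareSign
    exact if_congr (hint u v).symm rfl rfl
  let G (b : V) (w : ι → V) (u : V) : ℤ :=
    squareSign (B u u) * ∏ i, squareSign (B (u - (w i - b)) (u - (w i - b)))
  calc ∑ u, G a x u = ∑ u, G a x (u - a) := (Equiv.sum_comp (Equiv.subRight a) (G a x)).symm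
    _ = ∑ u, G (γ a) (γ ∘ x) (γ u - γ a) := by
        simp only [G, sub_sub_sub_cancel_right, hsign, Function.comp_apply]
    _ = ∑ u, G (γ a) (γ ∘ x) u := Equiv.sum_comp
        ((Equiv.ofBijective γ hγ).trans (Equiv.subRight (γ a))) (G (γ a) (γ ∘ x))

lemma apply_self_eq_zero_of_integral (hF : ringChar F ≠ 2) (hB : ∀ x y, B x y = B y x)
    (hnd : ∀ x, (∀ y, B x y = 0) → x = 0) (hV : 3 ≤ Module.finrank F V)
    (hγ : Function.Bijective γ)
    (hint : ∀ x y, IsSquare (B (x - y) (x - y)) ↔ IsSquare (B (γ x - γ y) (γ x - γ y)))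
    {a x : V} (hx : B (x - a) (x - a) = 0) : B (γ x - γ a) (γ x - γ a) = 0 := by
  by_contra hd
  have hxa : x - a ≠ 0 := fun h => hd (by rw [sub_eq_zero.mp h, sub_self, map_zero])
  obtain ⟨k, hk | hk⟩ := (Module.finrank F V).even_or_odd'
  · obtain ⟨k, rfl⟩ : ∃ l, k = l + 1 := ⟨k - 1, by lia⟩
    obtain ⟨ν, hν⟩ := FiniteField.exists_nonsquare hF
    obtain ⟨z, hyz, hzz⟩ := exists_orthogonal_apply_self_eq hF hB hnd hxa hx (by lia) hk
      (ν := ν) (by rintro rfl; exact hν IsSquare.zero)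
    have hdvd := dvd_sum_of_isotropic_of_orthogonal hF hB hnd hxa hx hyz
      (by rw [hzz]; rintro rfl; exact hν IsSquare.zero) (by lia : 1 ≤ k) hk
    have hsum := sum_squareSign_eq_of_integral hγ hint a ![x, z + a]
    simp only [Fin.prod_univ_two, Matrix.cons_val_zero, Matrix.cons_val_one,
      add_sub_cancel_right] at hsum
    rw [hsum] at hdvd
    have hsq : IsSquare (B (γ x - γ a) (γ x - γ a)) := (hint x a).mp (hx ▸ IsSquare.zero)
    have hnsq : ¬ IsSquare (B (γ (z + a) - γ a) (γ (z + a) - γ a)) := fun h =>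
      hν (by simpa [hzz] using (hint (z + a) a).mpr h)
    generalize γ x - γ a = v at *
    generalize γ (z + a) - γ a = w at *
    have hdet : B v v * B w w - B v w ^ 2 ≠ 0 := by
      intro h
      obtain ⟨s, hs⟩ := hsq
      have hs0 : s ≠ 0 := by
        rintro rfl
        exact hd (by simpa using hs)
      refine hnsq ⟨B v w / s, ?_⟩
      rw [hs] at h
      field_simp
      linear_combination h
    refine not_dvd_sum_of_dual hF hB hnd (x := ![v, w])
      (y := ![(B v v * B w w - B v w ^ 2)⁻¹ • (B w w • v - B v w • w),
        (B v v * B w w - B v w ^ 2)⁻¹ • (B v v • w - B v w • v)]) ?_ ?_ (by lia : 1 ≤ k)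
      (by simpa [mul_add] using hk) (by simpa [Fin.prod_univ_two] using hdvd)
    · have hwv := hB w v
      intro i j
      fin_cases i <;> fin_cases j <;> simp [hwv] <;>
        first | exact Or.inr (by ring) | field_simp
    · have hv : v ∈ Submodule.span F (Set.range ![v, w]) := Submodule.subset_span ⟨0, rfl⟩
      have hw : w ∈ Submodule.span F (Set.range ![v, w]) := Submodule.subset_span ⟨1, rfl⟩
      intro i
      fin_cases i
      · exact Submodule.smul_mem _ _
          (sub_mem (Submodule.smul_mem _ _ hv) (Submodule.smul_mem _ _ hw))
      · exact Submodule.smul_mem _ _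
          (sub_mem (Submodule.smul_mem _ _ hw) (Submodule.smul_mem _ _ hv))
  · have hdvd := dvd_sum_of_isotropic hF hB hnd hxa hx (by lia) hk
    have hsum := sum_squareSign_eq_of_integral hγ hint a fun _ : Unit => x
    simp only [Fintype.prod_unique] at hsum
    rw [hsum] at hdvd
    refine not_dvd_sum_of_dual hF hB hnd (x := fun _ : Unit => γ x - γ a)
      (y := fun _ => (B (γ x - γ a) (γ x - γ a))⁻¹ • (γ x - γ a)) (fun _ _ => ?_) (fun _ => ?_)
      (by lia : 1 ≤ k) (by simpa using hk) (by simpa using hdvd)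
    · rw [map_smul, LinearMap.smul_apply, smul_eq_mul, inv_mul_cancel₀ hd, if_pos rfl]
    · exact Submodule.smul_mem _ _ (Submodule.subset_span ⟨(), rfl⟩)

end Integral

end PairCount

/-- Let `p` be an odd prime, `q = p^h`, `n ≥ 3`. Every
integral automorphism `γ` of `𝔽_q^n` preserves the cones of the standard
bilinear form: for every `a ∈ 𝔽_q^n`,
`γ '' {x | ∑ (x_i - a_i)² = 0} = {x | ∑ (x_i - γ(a)_i)² = 0}`. -/
theorem integral_automorphism_preserves_cones
    (p h n : ℕ) (hp : p.Prime) (hodd : Odd p) (hn : 3 ≤ n)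
    (q : ℕ) (hq : q = p ^ h)
    (F : Type) [Field F] [Fintype F] (hF : Fintype.card F = q)
    (γ : (Fin n → F) → (Fin n → F)) (hγ : Function.Bijective γ)
    (hint : ∀ x y : Fin n → F,
      IsSquare (∑ j, (x j - y j) ^ 2) ↔ IsSquare (∑ j, (γ x j - γ y j) ^ 2)) :
    ∀ a : Fin n → F,
      γ '' {x : Fin n → F | (∑ j, (x j - a j) ^ 2) = 0} =
        {x : Fin n → F | (∑ j, (x j - γ a j) ^ 2) = 0} := by
  classical
  have hchar : ringChar F ≠ 2 := fun h2 => by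
    have h := FiniteField.even_card_of_char_two h2
    rw [hF, hq, ← Nat.even_iff] at h
    exact Nat.not_even_iff_odd.mpr hodd.pow h
  let B : LinearMap.BilinForm F (Fin n → F) := dotProductBilin F F
  have hB (x y : Fin n → F) : B x y = x ⬝ᵥ y := rfl
  have hsum (x y : Fin n → F) : ∑ j, (x j - y j) ^ 2 = B (x - y) (x - y) := by
    simp only [hB, dotProduct, sq, Pi.sub_apply]
  simp_rw [hsum] at hint ⊢
  have hsymm (x y : Fin n → F) : B x y = B y x := dotProduct_comm x y
  have hnd (x : Fin n → F) (h : ∀ y, B x y = 0) : x = 0 := dotProduct_eq_zero x h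
  have hfin : 3 ≤ Module.finrank F (Fin n → F) := by simpa using hn
  let e := Equiv.ofBijective γ hγ
  have he (x : Fin n → F) : γ (e.symm x) = x := e.apply_symm_apply x
  have hint' (x y : Fin n → F) : IsSquare (B (x - y) (x - y)) ↔
      IsSquare (B (e.symm x - e.symm y) (e.symm x - e.symm y)) := by
    simpa only [he] using (hint (e.symm x) (e.symm y)).symm
  intro a
  ext x
  constructor
  · rintro ⟨u, hu, rfl⟩
    exact apply_self_eq_zero_of_integral hchar hsymm hnd hfin hγ hint hu
  · intro hx
    refine ⟨e.symm x, ?_, he x⟩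
    have := apply_self_eq_zero_of_integral hchar hsymm hnd hfin e.symm.bijective hint' hx
    rwa [show e.symm (γ a) = a from e.symm_apply_apply a] at this
end
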